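/- Suppose ℓ does not divide P(q) and R = Z_ℓ[x]/(P(x)) has the few enlargements property. Let μ_R be the measure on isomorphism classes of finite R-modules given by μ_R(M) = c_R/#Aut_R(M) for M of projective dimension 1 and μ_R(M) = 0 otherwise, where c_R = ∏_j ∏_{i=1}^∞ (1 − |k_j|^{−i}) with the outer product over the residue fields k_j of R. Then for every finite set S of isomorphism classes of finite R-modules and every ε > 0, there exist δ > 0 and a finite set S' of isomorphism classes of finite R-modules such that: every probability measure ν on isomorphism classes of finite R-modules satisfying Σ_M ν(M)·#Surj_R(M, A') ∈ [1 − δ, 1 + δ] for all A' ∈ S' also satisfies |ν(A) − μ_R(A)| < ε for all A ∈ S. -/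

import Mathlib

/- STATEMENT 19: Suppose ℓ ∤ P(q) and R = ℤ_ℓ[x]/(P(x)) has the few enlargements
   property.  Let μ_R be the measure on isomorphism classes of finite R-modules given by
   μ_R(M) = c_R/#Aut_R(M) for M of projective dimension 1 and μ_R(M) = 0 otherwise,
   where c_R = ∏_j ∏_{i=1}^∞ (1 − |k_j|^{−i}) with the outer product over the residue
   fields of R.  Then for every finite set S of isomorphism classes of finite R-modules
   and every ε > 0, there exist δ > 0 and a finite set S' of isomorphism classes such
   that every probability measure ν with Σ_M ν(M)·#Surj_R(M, A') ∈ [1−δ, 1+δ] for all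
   A' ∈ S' satisfies |ν(A) − μ_R(A)| < ε for all A ∈ S.

   Isomorphism classes of finite R-modules are expressed via a complete irredundant
   family of representatives; length is the longest chain length in the submodule
   lattice; the counting of isomorphism classes of s-enlargements is expressed via
   finite pairwise non-isomorphic families. -/

open Filter

/-- The number of `R`-module automorphisms of `M`. -/
noncomputable def numAut (R M : Type) [CommRing R] [AddCommGroup M] [Module R M] : ℕ :=
  Nat.card (M ≃ₗ[R] M)

/-- The number of `R`-module surjections from `M` onto `M'`. -/
noncomputable def numSurj (R M M' : Type) [CommRing R] [AddCommGroup M] [Module R M]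
    [AddCommGroup M'] [Module R M'] : ℕ :=
  Nat.card {f : M →ₗ[R] M' // Function.Surjective f}

/-- `M` admits a projective resolution `0 → P₁ → P₀ → M → 0` of length 1. -/
def HasProjDimLEOne (R M : Type) [CommRing R] [AddCommGroup M] [Module R M] : Prop :=
  ∃ (P₀ P₁ : ModuleCat.{0} R) (f : P₁ →ₗ[R] P₀) (g : P₀ →ₗ[R] M),
    Module.Projective R P₀ ∧ Module.Projective R P₁ ∧
    Function.Injective f ∧ Function.Surjective g ∧ LinearMap.range f = LinearMap.ker g

/-- `c_R = ∏_j ∏_{i=1}^∞ (1 − |k_j|^{−i})`, the outer product over the residue fields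
`k_j = R/m_j` of `R` (i.e. over the maximal ideals of `R`). -/
noncomputable def cProd (R : Type) [CommRing R] : ℝ :=
  ∏ᶠ m : MaximalSpectrum R,
    ∏' i : ℕ, (1 - ((Nat.card (R ⧸ m.asIdeal) : ℝ))⁻¹ ^ (i + 1))

/-- The `R`-length of a module: the longest chain length in its submodule lattice. -/
noncomputable def modLength (R M : Type) [CommRing R] [AddCommGroup M] [Module R M] :
    WithBot ℕ∞ :=
  Order.krullDim (Submodule R M)

/-- `B` is an `s`-enlargement of `A`: a finite `R`-module admitting an `R`-module
surjection onto `A` whose kernel has `R`-length equal to `s`. -/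
def IsEnlargement (R : Type) [CommRing R] (s : ℕ) (B A : Type) [AddCommGroup B]
    [Module R B] [AddCommGroup A] [Module R A] : Prop :=
  Finite B ∧ ∃ φ : B →ₗ[R] A, Function.Surjective φ ∧
    modLength R (LinearMap.ker φ) = (s : ℕ∞)

/-- `R` has the few enlargements property: for every finite `R`-module `A`, the number
of isomorphism classes of `s`-enlargements of `A` is subexponential in `s`. -/
def HasFewEnlargements (R : Type) [CommRing R] : Prop :=
  ∀ (A : Type) [AddCommGroup A] [Module R A], Finite A → ∀ ε : ℝ, 0 < ε →
    ∀ᶠ s : ℕ in atTop,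
      ∀ (κ : Type) (B : κ → ModuleCat.{0} R), Finite κ →
        (∀ j, IsEnlargement R s (B j) A) →
        (∀ j j', Nonempty ((B j : Type) ≃ₗ[R] B j') → j = j') →
        (Nat.card κ : ℝ) ≤ Real.exp (ε * s)

open scoped Classical in
/-- The measure `μ_R(M) = c_R/#Aut_R(M)` for `M` of projective dimension 1, and `0`
otherwise, as a function on the index set of representatives. -/
noncomputable def muCL (R : Type) [CommRing R] (ι : Type) (Mod : ι → ModuleCat.{0} R)
    (i : ι) : ℝ :=
  if HasProjDimLEOne R (Mod i) then cProd R / (numAut R (Mod i) : ℝ) else 0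

open Filter

namespace FE

noncomputable def piq (q : ℝ) (i : ℕ) : ℝ := ∏ t ∈ Finset.range i, (q ^ (t + 1) - 1)

noncomputable def rho (q D : ℝ) (i : ℕ) : ℝ := (∏ t ∈ Finset.range i, (D - q ^ t)) / piq q i

noncomputable def gam (q : ℝ) (a i : ℕ) : ℝ := q ^ (a * i) / piq q i

lemma pow_sub_pos {q : ℝ} (hq : 1 < q) (t : ℕ) : 0 < q ^ (t + 1) - 1 := by
  have := one_lt_pow₀ hq (Nat.succ_ne_zero t)
  simpa using this

lemma piq_pos {q : ℝ} (hq : 1 < q) (i : ℕ) : 0 < piq q i :=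
  Finset.prod_pos fun t _ => pow_sub_pos hq t

lemma piq_succ (q : ℝ) (i : ℕ) : piq q (i + 1) = piq q i * (q ^ (i + 1) - 1) := by
  simp [piq, Finset.prod_range_succ]

lemma gam_pos {q : ℝ} (hq : 1 < q) (a i : ℕ) : 0 < gam q a i :=
  div_pos (pow_pos (by linarith) _) (piq_pos hq i)

lemma sum_rho {q : ℝ} (hq : 1 < q) (D : ℝ) (s : ℕ) :
    ∑ i ∈ Finset.range (s + 1), (-1) ^ i * rho q D i =
      ∏ i ∈ Finset.range s, (q ^ (i + 1) - D) / (q ^ (i + 1) - 1) := by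
  induction s with
  | zero => simp [rho, piq]
  | succ s ih =>
    rw [Finset.sum_range_succ, ih, Finset.prod_range_succ, rho, piq_succ,
      Finset.prod_range_succ']
    rw [Finset.prod_div_distrib]
    have h1 := (piq_pos hq s).ne'
    have h2 := (pow_sub_pos hq s).ne'
    have h3 : ∏ i ∈ Finset.range s, (q ^ (i + 1) - D)
        = (-1) ^ s * ∏ i ∈ Finset.range s, (D - q ^ (i + 1)) := by
      rw [← Finset.card_range s, ← Finset.prod_const, Finset.card_range,
        ← Finset.prod_mul_distrib]
      exact Finset.prod_congr rfl fun _ _ => by ring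
    rw [h3]
    change _ / piq q s + _ = _ / piq q s * _
    field_simp
    ring

lemma rho_nonneg {q : ℝ} (hq : 1 < q) (d s : ℕ) : 0 ≤ rho q (q ^ d) s := by
  refine div_nonneg ?_ (piq_pos hq s).le
  by_cases h : d < s
  · rw [Finset.prod_eq_zero (Finset.mem_range.2 h) (sub_self _)]
  · refine Finset.prod_nonneg fun t ht => ?_
    have : t ≤ d := by have := Finset.mem_range.1 ht; omega
    exact sub_nonneg.2 (pow_le_pow_right₀ hq.le this)

lemma rho_bound {q : ℝ} (hq : 1 < q) (d s : ℕ) :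
    |(if d = 0 then (1 : ℝ) else 0) - ∑ i ∈ Finset.range (s + 1), (-1) ^ i * rho q (q ^ d) i|
      ≤ rho q (q ^ d) s := by
  rw [sum_rho hq]
  rcases Nat.eq_zero_or_pos d with h0 | hpos
  · subst h0
    have : ∏ i ∈ Finset.range s, (q ^ (i + 1) - q ^ 0) / (q ^ (i + 1) - 1) = 1 := by
      refine Finset.prod_eq_one fun i _ => ?_
      rw [pow_zero, div_self (pow_sub_pos hq i).ne']
    rw [this]
    simpa using rho_nonneg hq 0 s
  · rw [if_neg hpos.ne']
    by_cases h : d ≤ s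
    · rw [Finset.prod_eq_zero (i := d - 1) (Finset.mem_range.2 (by omega))]
      · simpa using rho_nonneg hq d s
      · rw [Nat.sub_add_cancel hpos]; simp
    · rw [zero_sub, abs_neg, Finset.abs_prod, rho, piq, ← Finset.prod_div_distrib]
      refine Finset.prod_le_prod (fun _ _ => abs_nonneg _) fun i hi => ?_
      have hi' : i + 1 ≤ d := by have := Finset.mem_range.1 hi; omega
      rw [abs_div, abs_of_pos (pow_sub_pos hq i)]
      refine div_le_div_of_nonneg_right ?_ (pow_sub_pos hq i).le
      rw [abs_sub_comm, abs_of_nonneg (sub_nonneg.2 (pow_le_pow_right₀ hq.le hi'))]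
      have := pow_le_pow_right₀ hq.le (Nat.le_succ i)
      simp only [Nat.succ_eq_add_one] at this
      linarith

lemma summable_u {q : ℝ} (hq : 1 < q) (u : ℝ) :
    Summable fun i : ℕ => u ^ i / piq q i := by
  rcases eq_or_ne u 0 with rfl | hu
  · refine summable_of_ne_finset_zero (s := {0}) fun i hi => ?_
    have : i ≠ 0 := by simpa using hi
    simp [this]
  refine summable_of_ratio_test_tendsto_lt_one (l := 0) (by norm_num) ?_ ?_
  · exact Eventually.of_forall fun i => div_ne_zero (pow_ne_zero _ hu) (piq_pos hq i).ne'
  · have h : Tendsto (fun i : ℕ => |u| / (q ^ (i + 1) - 1)) atTop (nhds 0) := by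
      refine Tendsto.const_div_atTop ?_ _
      refine tendsto_atTop_add_const_right _ _ ?_
      exact (tendsto_pow_atTop_atTop_of_one_lt hq).comp (tendsto_add_atTop_nat 1)
    refine h.congr fun i => ?_
    have h1 := (piq_pos hq i)
    have h2 := (pow_sub_pos hq i)
    rw [piq_succ, Real.norm_eq_abs, Real.norm_eq_abs, abs_div, abs_div, abs_mul, abs_pow, abs_pow,
      abs_of_pos h1, abs_of_pos h2]
    have : |u| ≠ 0 := abs_ne_zero.2 hu
    field_simp
    ring

noncomputable def ff (q u : ℝ) : ℝ := ∑' i : ℕ, (-1) ^ i * (u ^ i / piq q i)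

lemma summable_ff {q : ℝ} (hq : 1 < q) (u : ℝ) :
    Summable fun i : ℕ => (-1) ^ i * (u ^ i / piq q i) := by
  refine (summable_u hq (-u)).congr fun i => ?_
  rw [neg_pow]; ring

lemma ff_fun {q : ℝ} (hq : 1 < q) (u : ℝ) : ff q (q * u) = (1 - u) * ff q u := by
  have e : ff q (q * u) - ff q u = - u * ff q u := by
    unfold ff
    rw [← (summable_ff hq _).tsum_sub (summable_ff hq u), ← tsum_mul_left,
      ((summable_ff hq _).sub (summable_ff hq u)).tsum_eq_zero_add]
    simp only [pow_zero, sub_self, zero_add]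
    refine tsum_congr fun i => ?_
    rw [piq_succ]
    have h1 := (piq_pos hq i).ne'
    have h2 := (pow_sub_pos hq i).ne'
    field_simp
    ring
  linarith

lemma ff_pow {q : ℝ} (hq : 1 < q) (a : ℕ) : ff q (q ^ (a + 1)) = 0 := by
  induction a with
  | zero =>
    have := ff_fun hq 1
    simpa using this
  | succ a ih => rw [pow_succ', ff_fun hq, ih, mul_zero]

lemma ff_near {q : ℝ} (hq : 1 < q) {u : ℝ} (h0 : 0 ≤ u) (h1 : u ≤ 1) :
    |ff q u - 1| ≤ u * ∑' i : ℕ, (1 : ℝ) ^ (i + 1) / piq q (i + 1) := by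
  have hs := (summable_nat_add_iff 1).2 (summable_u hq 1)
  have hs' : Summable fun i : ℕ => u * ((1 : ℝ) ^ (i + 1) / piq q (i + 1)) := hs.mul_left u
  unfold ff
  rw [(summable_ff hq u).tsum_eq_zero_add, ← tsum_mul_left]
  simp only [pow_zero, piq, Finset.range_zero, Finset.prod_empty, div_one, one_mul,
    add_sub_cancel_left]
  rw [← Real.norm_eq_abs]
  refine tsum_of_norm_bounded hs'.hasSum fun i => ?_
  change ‖_ * (_ / piq q (i + 1))‖ ≤ _
  rw [norm_mul, norm_pow, norm_neg, norm_one, one_pow, one_mul, norm_div,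
    Real.norm_of_nonneg (piq_pos hq _).le, norm_pow, Real.norm_of_nonneg h0, mul_one_div]
  refine div_le_div_of_nonneg_right ?_ (piq_pos hq _).le
  exact pow_le_of_le_one h0 h1 (Nat.succ_ne_zero i)

lemma ff_one {q : ℝ} (hq : 1 < q) : ff q 1 = ∏' i : ℕ, (1 - q⁻¹ ^ (i + 1)) := by
  have hq0 : q ≠ 0 := by linarith
  have hi0 : 0 ≤ q⁻¹ := by positivity
  have hi1 : q⁻¹ < 1 := inv_lt_one_of_one_lt₀ hq
  have hsum : Summable fun i : ℕ => -(q⁻¹ ^ (i + 1)) :=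
    ((summable_nat_add_iff 1).2 (summable_geometric_of_lt_one hi0 hi1)).neg
  have hm : Multipliable fun i : ℕ => (1 - q⁻¹ ^ (i + 1)) := by
    have := Real.multipliable_one_add_of_summable hsum
    simpa [sub_eq_add_neg] using this
  have ht := hm.hasProd.tendsto_prod_nat
  have hN : ∀ N : ℕ, ff q 1 = (∏ i ∈ Finset.range N, (1 - q⁻¹ ^ (i + 1))) * ff q (q⁻¹ ^ N) := by
    intro N
    induction N with
    | zero => simp
    | succ N ih =>
      rw [ih, Finset.prod_range_succ, mul_assoc, ← ff_fun hq]
      congr 2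
      rw [pow_succ', ← mul_assoc, mul_inv_cancel₀ hq0, one_mul]
  have hlim : Tendsto (fun N : ℕ => ff q (q⁻¹ ^ N)) atTop (nhds 1) := by
    rw [tendsto_iff_norm_sub_tendsto_zero]
    refine squeeze_zero (fun _ => norm_nonneg _)
      (fun N => ff_near hq (pow_nonneg hi0 N) (pow_le_one₀ hi0 hi1.le)) ?_
    simpa using (tendsto_pow_atTop_nhds_zero_of_lt_one hi0 hi1).mul_const
      (∑' i : ℕ, (1 : ℝ) ^ (i + 1) / piq q (i + 1))
  have := ht.mul hlim
  rw [mul_one] at this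
  refine tendsto_nhds_unique (tendsto_const_nhds.congr hN) this

lemma gam_tendsto {q : ℝ} (hq : 1 < q) (a : ℕ) : Tendsto (gam q a) atTop (nhds 0) := by
  have := (summable_u hq (q ^ a)).tendsto_atTop_zero
  refine this.congr fun i => ?_
  rw [gam, pow_mul]

lemma gam_sum_tendsto {q : ℝ} (hq : 1 < q) (a : ℕ) :
    Tendsto (fun s => ∑ i ∈ Finset.range (s + 1), (-1) ^ i * gam q a i) atTop
      (nhds (if a = 0 then ∏' i : ℕ, (1 - q⁻¹ ^ (i + 1)) else 0)) := by
  have h : Tendsto (fun s => ∑ i ∈ Finset.range (s + 1), (-1) ^ i * gam q a i) atTop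
      (nhds (ff q (q ^ a))) := by
    have := (summable_ff hq (q ^ a)).hasSum.tendsto_sum_nat.comp (tendsto_add_atTop_nat 1)
    refine this.congr fun s => ?_
    simp only [Function.comp]
    exact Finset.sum_congr rfl fun i _ => by rw [gam, pow_mul]
  convert h using 2
  rcases a with _ | a
  · simp [ff_one hq]
  · simp [ff_pow hq]

/-- product comparison -/
lemma prod_sub_bound {ι : Type*} (s : Finset ι) (a b e : ι → ℝ) (ha : ∀ i, |a i| ≤ 1)
    (he : ∀ i, |a i - b i| ≤ e i) :
    |∏ i ∈ s, a i - ∏ i ∈ s, b i| ≤ ∏ i ∈ s, (1 + e i) - 1 := by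
  classical
  have he0 : ∀ i, 0 ≤ e i := fun i => (abs_nonneg _).trans (he i)
  induction s using Finset.induction_on with
  | empty => simp
  | insert j s hj ih =>
    rw [Finset.prod_insert hj, Finset.prod_insert hj, Finset.prod_insert hj]
    have hb : |b j| ≤ 1 + e j := by
      have : b j = a j - (a j - b j) := by ring
      rw [this]; exact (abs_sub _ _).trans (add_le_add (ha j) (he j))
    have hA : |∏ i ∈ s, a i| ≤ 1 := by
      rw [Finset.abs_prod]; exact Finset.prod_le_one (fun _ _ => abs_nonneg _) fun i _ => ha i
    have : a j * ∏ i ∈ s, a i - b j * ∏ i ∈ s, b i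
      = (a j - b j) * ∏ i ∈ s, a i + b j * (∏ i ∈ s, a i - ∏ i ∈ s, b i) := by ring
    rw [this]
    refine (abs_add_le _ _).trans ?_
    rw [abs_mul, abs_mul]
    have h1 : |a j - b j| * |∏ i ∈ s, a i| ≤ e j * 1 :=
      mul_le_mul (he j) hA (abs_nonneg _) (he0 j)
    have h2 : |b j| * |∏ i ∈ s, a i - ∏ i ∈ s, b i| ≤ (1 + e j) * (∏ i ∈ s, (1 + e i) - 1) :=
      mul_le_mul hb ih (abs_nonneg _) (by linarith [he0 j])
    linarith

end FE

open Filter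
namespace FE

section cnt
variable {R : Type} [CommRing R]

lemma surj_pi_iff (m : Ideal R) [hm : m.IsMaximal] {N : Type} [AddCommGroup N] [Module R N]
    {i : ℕ} (s : Fin i → (N →ₗ[R] R ⧸ m)) :
    letI := Ideal.Quotient.field m
    Function.Surjective (LinearMap.pi s) ↔ LinearIndependent (R ⧸ m) s := by
  letI := Ideal.Quotient.field m
  constructor
  · intro h
    rw [Fintype.linearIndependent_iff]
    intro c hc j
    obtain ⟨x, hx⟩ := h (Pi.single j 1)
    have h1 := LinearMap.congr_fun hc x
    simp only [LinearMap.sum_apply, LinearMap.smul_apply, LinearMap.zero_apply] at h1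
    have h2 : ∀ t, s t x = (Pi.single j 1 : Fin i → R ⧸ m) t := fun t => by rw [← hx]; rfl
    simpa [h2, Pi.single_apply] using h1
  · intro h
    let W : Submodule (R ⧸ m) (Fin i → R ⧸ m) :=
      { carrier := Set.range (LinearMap.pi s)
        add_mem' := by
          rintro _ _ ⟨a, rfl⟩ ⟨b, rfl⟩
          exact ⟨a + b, map_add _ _ _⟩
        zero_mem' := ⟨0, map_zero _⟩
        smul_mem' := by
          rintro c _ ⟨a, rfl⟩
          obtain ⟨r, rfl⟩ := Ideal.Quotient.mk_surjective c
          exact ⟨r • a, by rw [map_smul]; rfl⟩ }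
    by_contra hns
    have hW : W < ⊤ := by
      rw [lt_top_iff_ne_top]
      intro hT
      apply hns
      intro y
      have : y ∈ W := hT ▸ Submodule.mem_top
      exact this
    obtain ⟨φ, hφ, hle⟩ := W.exists_le_ker_of_lt_top hW
    apply hφ
    rw [Fintype.linearIndependent_iff] at h
    have key := h (fun j => φ (Pi.single j 1)) (by
      ext x
      simp only [LinearMap.sum_apply, LinearMap.smul_apply, LinearMap.zero_apply]
      have : φ (LinearMap.pi s x) = 0 := hle ⟨x, rfl⟩
      rw [LinearMap.pi_apply_eq_sum_univ φ] at this
      rw [← this]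
      refine Finset.sum_congr rfl fun j _ => ?_
      simp only [smul_eq_mul, LinearMap.pi_apply]
      rw [mul_comm]
      congr 2
      ext t
      simp [Pi.single_apply, eq_comm])
    ext j
    simpa using key j

lemma surj_count (m : Ideal R) [hm : m.IsMaximal] [Finite (R ⧸ m)]
    (N : Type) [AddCommGroup N] [Module R N] [Finite (N →ₗ[R] R ⧸ m)] :
    ∃ d : ℕ, Nat.card (N →ₗ[R] R ⧸ m) = Nat.card (R ⧸ m) ^ d ∧
      ∀ i : ℕ, (numSurj R N (Fin i → R ⧸ m) : ℝ) =
        ∏ t ∈ Finset.range i, ((Nat.card (R ⧸ m) : ℝ) ^ d - (Nat.card (R ⧸ m) : ℝ) ^ t) := by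
  letI := Ideal.Quotient.field m
  haveI : Fintype (R ⧸ m) := Fintype.ofFinite _
  haveI : Fintype (N →ₗ[R] R ⧸ m) := Fintype.ofFinite _
  haveI : Module.Finite (R ⧸ m) (N →ₗ[R] R ⧸ m) := Module.Finite.of_finite
  refine ⟨Module.finrank (R ⧸ m) (N →ₗ[R] R ⧸ m), Module.natCard_eq_pow_finrank, fun i => ?_⟩
  have e : numSurj R N (Fin i → R ⧸ m) =
      Nat.card {s : Fin i → (N →ₗ[R] R ⧸ m) // LinearIndependent (R ⧸ m) s} := by
    refine (Nat.card_congr ?_).symm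
    refine Equiv.subtypeEquiv
      ⟨fun s => LinearMap.pi s, fun f j => (LinearMap.proj j).comp f, fun s => by ext; rfl,
        fun f => by ext; rfl⟩ fun s => (surj_pi_iff m s).symm
  rw [e]
  by_cases hi : i ≤ Module.finrank (R ⧸ m) (N →ₗ[R] R ⧸ m)
  · rw [card_linearIndependent hi, Nat.cast_prod,
      ← Fin.prod_univ_eq_prod_range (fun t => ((Nat.card (R ⧸ m) : ℝ) ^ _ - (Nat.card (R ⧸ m) : ℝ) ^ t))]
    refine Finset.prod_congr rfl fun t _ => ?_
    rw [Nat.card_eq_fintype_card, Nat.cast_sub]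
    · push_cast; rfl
    · exact Nat.pow_le_pow_right Fintype.card_pos (by omega)
  · rw [Finset.prod_eq_zero (Finset.mem_range.2 (not_le.1 hi)) (sub_self _)]
    have : IsEmpty {s : Fin i → (N →ₗ[R] R ⧸ m) // LinearIndependent (R ⧸ m) s} := by
      refine ⟨fun s => hi ?_⟩
      simpa using s.2.fintype_card_le_finrank
    simp

end cnt
end FE

open Filter
namespace FE

section crt
variable {R : Type} [CommRing R]

abbrev VV (R : Type) [CommRing R] (i : MaximalSpectrum R → ℕ) : Type :=
  (m : MaximalSpectrum R) → (Fin (i m) → R ⧸ m.asIdeal)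

lemma exists_idem [Finite (MaximalSpectrum R)] (m : MaximalSpectrum R) :
    ∃ e : R, (e - 1 ∈ m.asIdeal) ∧ ∀ m' : MaximalSpectrum R, m' ≠ m → e ∈ m'.asIdeal := by
  classical
  have hI : Pairwise (Function.onFun IsCoprime (fun m : MaximalSpectrum R => m.asIdeal)) := by
    intro a b hab
    have := a.isMaximal
    have := b.isMaximal
    exact Ideal.isCoprime_of_isMaximal fun h => hab (MaximalSpectrum.ext h)
  obtain ⟨r, hr⟩ := Ideal.exists_forall_sub_mem_ideal hI (fun m' => if m' = m then 1 else 0)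
  refine ⟨r, by simpa using hr m, fun m' hm' => by simpa [hm'] using hr m'⟩

/-- joint surjectivity onto modules killed by distinct maximal ideals -/
lemma joint_surj [Finite (MaximalSpectrum R)] {N : Type} [AddCommGroup N] [Module R N]
    {V : MaximalSpectrum R → Type} [∀ m, AddCommGroup (V m)] [∀ m, Module R (V m)]
    (hV : ∀ m, ∀ r ∈ m.asIdeal, ∀ v : V m, r • v = 0)
    (f : ∀ m, N →ₗ[R] V m) (hf : ∀ m, Function.Surjective (f m)) :
    Function.Surjective (LinearMap.pi f) := by
  classical
  have := Fintype.ofFinite (MaximalSpectrum R)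
  intro y
  choose x hx using fun m => hf m (y m)
  choose e he1 he2 using fun m => exists_idem (R := R) m
  refine ⟨∑ m, e m • x m, ?_⟩
  ext m'
  rw [LinearMap.pi_apply, map_sum, Finset.sum_eq_single m']
  · rw [map_smul, hx]
    have := hV m' _ (he1 m') (y m')
    rwa [sub_smul, one_smul, sub_eq_zero] at this
  · intro m _ hm
    rw [map_smul]
    exact hV m' _ (he2 m m' hm.symm) _
  · simp

lemma smul_quot_eq_zero (m : Ideal R) (r : R) (hr : r ∈ m) {n : ℕ} (v : Fin n → R ⧸ m) :
    r • v = 0 := by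
  ext j
  obtain ⟨y, hy⟩ := Ideal.Quotient.mk_surjective (v j)
  rw [Pi.smul_apply, ← hy, Pi.zero_apply]
  change Ideal.Quotient.mk m (r * y) = 0
  exact Ideal.Quotient.eq_zero_iff_mem.2 (m.mul_mem_right _ hr)

lemma numSurj_VV [Fintype (MaximalSpectrum R)] (N : Type) [AddCommGroup N] [Module R N]
    (i : MaximalSpectrum R → ℕ) :
    numSurj R N (VV R i) = ∏ m : MaximalSpectrum R, numSurj R N (Fin (i m) → R ⧸ m.asIdeal) := by
  unfold numSurj
  rw [← Nat.card_pi]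
  refine Nat.card_congr ⟨fun f m => ⟨(LinearMap.proj m).comp f.1, ?_⟩,
    fun g => ⟨LinearMap.pi fun m => (g m).1, ?_⟩, fun f => ?_, fun g => ?_⟩
  · exact (Function.surjective_eval m).comp f.2
  · exact joint_surj (fun m r hr v => smul_quot_eq_zero _ r hr v) _ fun m => (g m).2
  · rfl
  · rfl

lemma exists_hom_ne_zero (C : Type) [AddCommGroup C] [Module R C] [Module.Finite R C]
    [Nontrivial C] : ∃ m : Ideal R, m.IsMaximal ∧ ∃ φ : C →ₗ[R] R ⧸ m, φ ≠ 0 := by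
  obtain ⟨W, hW, -⟩ := (eq_top_or_exists_le_coatom (⊥ : Submodule R C)).resolve_left bot_ne_top
  have hs : IsSimpleModule R (C ⧸ W) := isSimpleModule_iff_isCoatom.2 hW
  obtain ⟨m, hm, ⟨e⟩⟩ := isSimpleModule_iff_quot_maximal.1 hs
  refine ⟨m, hm, e.toLinearMap.comp W.mkQ, fun h => hW.1 ?_⟩
  rw [eq_top_iff]
  intro x _
  have := LinearMap.congr_fun h x
  simpa using this

lemma exists_smul_zero (m : Ideal R) [hm : m.IsMaximal] (C : Type) [AddCommGroup C] [Module R C]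
    [Module.Finite R C] (h : ∀ φ : C →ₗ[R] R ⧸ m, φ = 0) : ∃ s : R, s ∉ m ∧ ∀ c : C, s • c = 0 := by
  have hle : (⊤ : Submodule R C) ≤ m • ⊤ := by
    by_contra hn
    have hn' : m • (⊤ : Submodule R C) ≠ ⊤ := fun h => hn h.ge
    have : Nontrivial (C ⧸ m • (⊤ : Submodule R C)) := Submodule.Quotient.nontrivial_iff.2 hn'
    obtain ⟨m', hm', φ, hφ⟩ := exists_hom_ne_zero (R := R) (C ⧸ m • (⊤ : Submodule R C))
    have hmm : m = m' := by
      refine hm.eq_of_le hm'.ne_top fun a ha => ?_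
      obtain ⟨c, hc⟩ : ∃ c, φ c ≠ 0 := by
        by_contra hcon
        push Not at hcon
        exact hφ (LinearMap.ext hcon)
      obtain ⟨c, rfl⟩ := Submodule.mkQ_surjective _ c
      have h1 : a • φ (Submodule.mkQ _ c) = 0 := by
        rw [← map_smul, ← map_smul]
        have : (m • (⊤ : Submodule R C)).mkQ (a • c) = 0 := by
          rw [Submodule.mkQ_apply, Submodule.Quotient.mk_eq_zero]
          exact Submodule.smul_mem_smul ha Submodule.mem_top
        rw [this, map_zero]
      letI := Ideal.Quotient.field m'
      have h2 : Ideal.Quotient.mk m' a * φ (Submodule.mkQ _ c) = 0 := by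
        rw [← h1]; rfl
      exact Ideal.Quotient.eq_zero_iff_mem.1 ((mul_eq_zero.1 h2).resolve_right hc)
    subst hmm
    apply hφ
    have := h (φ.comp (Submodule.mkQ _))
    ext c
    exact LinearMap.congr_fun this c
  obtain ⟨s, hs, hz⟩ := Submodule.exists_sub_one_mem_and_smul_eq_zero_of_fg_of_le_smul m ⊤
    Module.Finite.fg_top hle
  refine ⟨s, fun hsm => hm.ne_top ?_, fun c => hz c Submodule.mem_top⟩
  rw [Ideal.eq_top_iff_one]
  have := m.sub_mem hsm hs
  simpa using this

lemma one_lt_card (m : Ideal R) [hm : m.IsMaximal] [Finite (R ⧸ m)] : 1 < Nat.card (R ⧸ m) := by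
  letI := Ideal.Quotient.field m
  exact Finite.one_lt_card

lemma dual_system (m : Ideal R) [hm : m.IsMaximal] [Finite (R ⧸ m)]
    (N : Type) [AddCommGroup N] [Module R N] [Finite (N →ₗ[R] R ⧸ m)] (d : ℕ)
    (hd : Nat.card (N →ₗ[R] R ⧸ m) = Nat.card (R ⧸ m) ^ d) :
    ∃ (x : Fin d → N) (Φ : Fin d → (N →ₗ[R] R ⧸ m)),
      (∀ i j, Φ i (x j) = if i = j then 1 else 0) ∧
      ∀ φ : N →ₗ[R] R ⧸ m, (∀ j, φ (x j) = 0) → φ = 0 := by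
  letI := Ideal.Quotient.field m
  have : Module.Finite (R ⧸ m) (N →ₗ[R] R ⧸ m) := Module.Finite.of_finite
  have hfr : Module.finrank (R ⧸ m) (N →ₗ[R] R ⧸ m) = d := by
    have h1 : Nat.card (N →ₗ[R] R ⧸ m) = Nat.card (R ⧸ m) ^ _ :=
      Module.natCard_eq_pow_finrank (K := R ⧸ m)
    rw [hd] at h1
    exact (Nat.pow_right_injective (one_lt_card m) h1).symm
  let b := Module.finBasisOfFinrankEq (R ⧸ m) (N →ₗ[R] R ⧸ m) hfr
  have hs := (surj_pi_iff m b).2 b.linearIndependent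
  choose x hx using fun j : Fin d => hs (Pi.single j 1)
  have hxx : ∀ i j, b i (x j) = if i = j then 1 else 0 := by
    intro i j
    have := congrFun (hx j) i
    rw [LinearMap.pi_apply] at this
    rw [this, Pi.single_apply]
  refine ⟨x, b, hxx, fun φ hφ => ?_⟩
  rw [← b.sum_repr φ]
  refine Finset.sum_eq_zero fun j _ => ?_
  have := hφ j
  rw [← b.sum_repr φ] at this
  simp only [LinearMap.sum_apply, LinearMap.smul_apply, hxx, smul_eq_mul, mul_ite, mul_one,
    mul_zero, Finset.sum_ite_eq', Finset.mem_univ, if_true] at this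
  rw [this, zero_smul]

end crt
end FE

open Filter
set_option linter.style.haveILetI false
set_option linter.unusedSectionVars false
namespace FE

section struct
variable {R : Type} [CommRing R]

lemma finite_hom (N B : Type) [AddCommGroup N] [Module R N] [Module.Finite R N]
    [AddCommGroup B] [Module R B] [Finite B] : Finite (N →ₗ[R] B) := by
  obtain ⟨n, f, hf⟩ := Module.Finite.exists_fin' R N
  refine Finite.of_injective (fun φ : N →ₗ[R] B => fun j : Fin n => φ (f (Pi.single j 1))) ?_
  intro φ ψ h
  have : φ.comp f = ψ.comp f := by
    ext j
    simpa using congrFun h j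
  ext x
  obtain ⟨y, rfl⟩ := hf x
  exact LinearMap.congr_fun this y

lemma det_zero_mat {d r : ℕ} (h : d < r) (M₁ : Matrix (Fin r) (Fin d) R)
    (M₂ : Matrix (Fin d) (Fin r) R) : (M₁ * M₂).det = 0 := by
  obtain ⟨e, rfl⟩ : ∃ e, r = d + (e + 1) := ⟨r - d - 1, by omega⟩
  let A : Matrix (Fin (d + (e + 1))) (Fin (d + (e + 1))) R :=
    Matrix.of fun a b => Fin.addCases (motive := fun _ => R) (fun j => M₁ a j) (fun _ => 0) b
  let B : Matrix (Fin (d + (e + 1))) (Fin (d + (e + 1))) R :=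
    Matrix.of fun b a => Fin.addCases (motive := fun _ => R) (fun j => M₂ j a) (fun _ => 0) b
  have : M₁ * M₂ = A * B := by
    ext a b
    rw [Matrix.mul_apply, Matrix.mul_apply, Fin.sum_univ_add]
    simp [A, B]
  rw [this, Matrix.det_mul, Matrix.det_eq_zero_of_column_eq_zero (Fin.natAdd d (0 : Fin (e + 1))),
    zero_mul]
  intro i
  simp [A]

lemma det_zero {d r : ℕ} (h : d < r) (A : (Fin r → R) →ₗ[R] (Fin d → R))
    (B : (Fin d → R) →ₗ[R] (Fin r → R)) : LinearMap.det (B ∘ₗ A) = 0 := by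
  rw [← LinearMap.det_toMatrix', LinearMap.toMatrix'_comp]
  exact det_zero_mat h _ _

lemma det_smul_fin {r : ℕ} (c : R) (f : (Fin r → R) →ₗ[R] (Fin r → R)) :
    LinearMap.det (c • f) = c ^ r * LinearMap.det f := by
  rw [← LinearMap.det_toMatrix', ← LinearMap.det_toMatrix', map_smul, Matrix.det_smul,
    Fintype.card_fin]

lemma lift_free {r : ℕ} {X Y : Type} [AddCommGroup X] [Module R X] [AddCommGroup Y] [Module R Y]
    (φ : X →ₗ[R] Y) (θ : (Fin r → R) →ₗ[R] Y) (h : ∀ v, ∃ x, φ x = θ v) :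
    ∃ ψ : (Fin r → R) →ₗ[R] X, φ ∘ₗ ψ = θ := by
  choose w hw using fun j : Fin r => h (Pi.single j 1)
  refine ⟨(Pi.basisFun R (Fin r)).constr R w, ?_⟩
  refine (Pi.basisFun R (Fin r)).ext fun j => ?_
  rw [LinearMap.comp_apply, Module.Basis.constr_basis, hw, Pi.basisFun_apply]

lemma sep_span (m : Ideal R) [hm : m.IsMaximal] {N : Type} [AddCommGroup N] [Module R N]
    [Module.Finite R N] {d : ℕ} (x : Fin d → N)
    (h : ∀ φ : N →ₗ[R] R ⧸ m, (∀ j, φ (x j) = 0) → φ = 0) :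
    ∃ s : R, s ∉ m ∧ ∀ n : N, ∃ w, Fintype.linearCombination R x w = s • n := by
  obtain ⟨s, hs, hz⟩ := exists_smul_zero m (N ⧸ Submodule.span R (Set.range x)) (by
    intro φ
    have := h (φ.comp (Submodule.mkQ _)) (by
      intro j
      rw [LinearMap.comp_apply]
      have : (Submodule.span R (Set.range x)).mkQ (x j) = 0 := by
        rw [Submodule.mkQ_apply, Submodule.Quotient.mk_eq_zero]
        exact Submodule.subset_span ⟨j, rfl⟩
      rw [this, map_zero])
    ext c
    exact LinearMap.congr_fun this c)
  refine ⟨s, hs, fun n => ?_⟩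
  have := hz (Submodule.Quotient.mk n)
  rw [← Submodule.Quotient.mk_smul, Submodule.Quotient.mk_eq_zero,
    ← Fintype.range_linearCombination] at this
  exact this

section A
variable {A : Type} [AddCommGroup A] [Module R A] [Finite A] {r : ℕ}
  (F : (Fin r → R) →ₗ[R] A)

lemma card_smul_mem (v : Fin r → R) : ((Nat.card A : ℕ) : R) • v ∈ LinearMap.ker F := by
  rw [LinearMap.mem_ker, map_smul, Nat.cast_smul_eq_nsmul]
  exact card_nsmul_eq_zero'

/-- multiplication by `#A` as a map to the kernel -/
noncomputable def theta : (Fin r → R) →ₗ[R] LinearMap.ker F :=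
  (((Nat.card A : ℕ) : R) • LinearMap.id).codRestrict _ (card_smul_mem F)

lemma theta_apply (v : Fin r → R) : (theta F v : Fin r → R) = ((Nat.card A : ℕ) : R) • v := rfl

lemma pow_reg (hreg : ∀ c : ℕ, c ≠ 0 → ∀ x : R, (c : R) * x = 0 → x = 0) (n : ℕ) (x : R)
    (h : ((Nat.card A : ℕ) : R) ^ n * x = 0) : x = 0 := by
  refine hreg (Nat.card A ^ n) (pow_ne_zero _ Nat.card_pos.ne') x ?_
  push_cast
  exact h

lemma rank_ge [IsNoetherianRing R]
    (hreg : ∀ c : ℕ, c ≠ 0 → ∀ x : R, (c : R) * x = 0 → x = 0)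
    (m : Ideal R) [hm : m.IsMaximal] [Finite (R ⧸ m)] (d : ℕ)
    (hd : Nat.card (LinearMap.ker F →ₗ[R] R ⧸ m) = Nat.card (R ⧸ m) ^ d) : r ≤ d := by
  have := finite_hom (R := R) (LinearMap.ker F) (R ⧸ m)
  obtain ⟨x, Φ, -, hsep⟩ := dual_system m (LinearMap.ker F) d hd
  obtain ⟨s, hs, hsn⟩ := sep_span m x hsep
  obtain ⟨ψ, hψ⟩ := lift_free (Fintype.linearCombination R x) (s • theta F)
    (fun v => hsn (theta F v))
  by_contra hlt
  have h1 := det_zero (not_le.1 hlt) ψ ((LinearMap.ker F).subtype ∘ₗ Fintype.linearCombination R x)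
  have h2 : ((LinearMap.ker F).subtype ∘ₗ Fintype.linearCombination R x) ∘ₗ ψ
      = (s * (Nat.card A : R)) • LinearMap.id := by
    rw [LinearMap.comp_assoc, hψ]
    ext v
    simp [theta_apply, mul_assoc]
  rw [h2, det_smul_fin, LinearMap.det_id, mul_one] at h1
  · rw [mul_pow, mul_comm] at h1
    have h3 := pow_reg (A := A) hreg _ _ h1
    exact hs (hm.isPrime.mem_of_pow_mem r (h3 ▸ m.zero_mem))

lemma rank_le [IsNoetherianRing R]
    (hreg : ∀ c : ℕ, c ≠ 0 → ∀ x : R, (c : R) * x = 0 → x = 0)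
    (m : Ideal R) [hm : m.IsMaximal] [Finite (R ⧸ m)] (d : ℕ)
    (hd : Nat.card (LinearMap.ker F →ₗ[R] R ⧸ m) = Nat.card (R ⧸ m) ^ d)
    (hproj : Module.Projective R (LinearMap.ker F)) : d ≤ r := by
  have := finite_hom (R := R) (LinearMap.ker F) (R ⧸ m)
  obtain ⟨x, Φ, hΦ, hsep⟩ := dual_system m (LinearMap.ker F) d hd
  obtain ⟨s, hs, hsn⟩ := sep_span m x hsep
  set φ := Fintype.linearCombination R x with hφ
  obtain ⟨ψ, hψ⟩ := Module.projective_lifting_property φ.rangeRestrict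
    ((s • LinearMap.id : LinearMap.ker F →ₗ[R] LinearMap.ker F).codRestrict (LinearMap.range φ)
      (fun n => hsn n)) φ.surjective_rangeRestrict
  have hψ' : ∀ n, φ (ψ n) = s • n := fun n => congrArg Subtype.val (LinearMap.congr_fun hψ n)
  by_contra hlt
  have h1 := det_zero (not_le.1 hlt) ((LinearMap.ker F).subtype ∘ₗ φ) (ψ ∘ₗ theta F)
  have h2 : (ψ ∘ₗ theta F) ∘ₗ ((LinearMap.ker F).subtype ∘ₗ φ)
      = (Nat.card A : R) • (ψ ∘ₗ φ) := by
    refine LinearMap.ext fun v => ?_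
    simp only [LinearMap.comp_apply, LinearMap.smul_apply]
    rw [← map_smul]
    congr 1
  rw [h2, det_smul_fin] at h1
  have h3 := pow_reg (A := A) hreg _ _ h1
  have key : ∀ v i, (ψ (φ v) - s • v) i ∈ m := by
    intro v i
    have h4 : φ (ψ (φ v) - s • v) = 0 := by
      rw [map_sub, hψ', map_smul, sub_self]
    have h5 := congrArg (Φ i) h4
    rw [hφ, Fintype.linearCombination_apply, map_sum, map_zero] at h5
    simp only [map_smul, hΦ] at h5
    rw [Finset.sum_eq_single i] at h5
    · rw [if_pos rfl] at h5
      rw [← Ideal.Quotient.eq_zero_iff_mem, ← h5]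
      change _ = Ideal.Quotient.mk m (_ * 1)
      rw [mul_one]
    · intro b _ hb; simp [hb.symm]
    · simp
  have h6 : (LinearMap.toMatrix' (ψ ∘ₗ φ)).map (Ideal.Quotient.mk m)
      = (Ideal.Quotient.mk m s) • (1 : Matrix (Fin d) (Fin d) (R ⧸ m)) := by
    ext i j
    rw [Matrix.map_apply, LinearMap.toMatrix'_apply, Matrix.smul_apply, Matrix.one_apply]
    have := key (Pi.single j 1) i
    rw [← Ideal.Quotient.eq_zero_iff_mem, Pi.sub_apply, map_sub, sub_eq_zero] at this
    rw [LinearMap.comp_apply]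
    refine this.trans ?_
    rw [Pi.smul_apply, Pi.single_apply]
    split_ifs <;> simp
  have h7 := congrArg Matrix.det h6
  rw [← RingHom.mapMatrix_apply, ← RingHom.map_det, LinearMap.det_toMatrix', h3, map_zero,
    Matrix.det_smul, Matrix.det_one, mul_one, ← map_pow] at h7
  exact hs (hm.isPrime.mem_of_pow_mem _ (Ideal.Quotient.eq_zero_iff_mem.1 h7.symm))

lemma ker_projective (hF : Function.Surjective F) (hpd : HasProjDimLEOne R A) :
    Module.Projective R (LinearMap.ker F) := by
  obtain ⟨P₀, P₁, f, g, hP₀, hP₁, hf, hg, hfg⟩ := hpd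
  obtain ⟨a, ha⟩ := Module.projective_lifting_property g F hg
  obtain ⟨b, hb⟩ := Module.projective_lifting_property F g hF
  have ha' : ∀ v, g (a v) = F v := fun v => LinearMap.congr_fun ha v
  have hb' : ∀ v, F (b v) = g v := fun v => LinearMap.congr_fun hb v
  let e := LinearEquiv.ofInjective f hf
  let a' : LinearMap.ker F →ₗ[R] LinearMap.range f :=
    (a ∘ₗ (LinearMap.ker F).subtype).codRestrict _ (by
      intro n
      rw [hfg, LinearMap.mem_ker, LinearMap.comp_apply, ha']
      exact n.2)
  let i : LinearMap.ker F →ₗ[R] (P₁ × (Fin r → R)) :=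
    (e.symm.toLinearMap ∘ₗ a').prod (LinearMap.ker F).subtype
  let ρ : (P₁ × (Fin r → R)) →ₗ[R] LinearMap.ker F :=
    ((b ∘ₗ f).coprod (LinearMap.id - b ∘ₗ a)).codRestrict _ (by
      rintro ⟨p, v⟩
      have : g (f p) = 0 := by
        have : f p ∈ LinearMap.ker g := hfg ▸ ⟨p, rfl⟩
        exact this
      simp [hb', ha', this])
  refine Module.Projective.of_split i ρ ?_
  refine LinearMap.ext fun n => ?_
  apply Subtype.ext
  have h1 : f (e.symm (a' n)) = a n := by
    have := e.apply_symm_apply (a' n)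
    exact congrArg Subtype.val this
  change b (f (e.symm (a' n))) + ((n : Fin r → R) - b (a n)) = n
  rw [h1]
  abel

lemma pd_of_ranks [IsNoetherianRing R] [Finite (MaximalSpectrum R)]
    (hreg : ∀ c : ℕ, c ≠ 0 → ∀ x : R, (c : R) * x = 0 → x = 0) (hF : Function.Surjective F)
    [hfin : ∀ m : MaximalSpectrum R, Finite (R ⧸ m.asIdeal)]
    (hd : ∀ m : MaximalSpectrum R,
      Nat.card (LinearMap.ker F →ₗ[R] R ⧸ m.asIdeal) = Nat.card (R ⧸ m.asIdeal) ^ r) :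
    HasProjDimLEOne R A := by
  classical
  have := Fintype.ofFinite (MaximalSpectrum R)
  have h0 : ∀ m : MaximalSpectrum R, ∃ x : Fin r → LinearMap.ker F,
      ∀ φ : LinearMap.ker F →ₗ[R] R ⧸ m.asIdeal, (∀ j, φ (x j) = 0) → φ = 0 := by
    intro m
    have := m.isMaximal
    have := finite_hom (R := R) (LinearMap.ker F) (R ⧸ m.asIdeal)
    obtain ⟨x, Φ, -, hsep⟩ := dual_system m.asIdeal (LinearMap.ker F) r (hd m)
    exact ⟨x, hsep⟩
  choose x hx using h0
  choose e he1 he2 using fun m => exists_idem (R := R) m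
  let y : Fin r → LinearMap.ker F := fun j => ∑ m, e m • x m j
  have hy : ∀ m : MaximalSpectrum R, ∀ φ : LinearMap.ker F →ₗ[R] R ⧸ m.asIdeal,
      ∀ j, φ (y j) = φ (x m j) := by
    have hz : ∀ (m : MaximalSpectrum R) (c : R) (v : R ⧸ m.asIdeal), c ∈ m.asIdeal → c • v = 0 := by
      intro m c v hc
      have := congrFun (smul_quot_eq_zero m.asIdeal c hc (n := 1) (fun _ => v)) 0
      simpa using this
    intro m φ j
    simp only [y]
    rw [map_sum, Finset.sum_eq_single m]
    · rw [map_smul]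
      have := hz m _ (φ (x m j)) (he1 m)
      rwa [sub_smul, one_smul, sub_eq_zero] at this
    · intro m' _ hm'
      rw [map_smul]
      exact hz m _ _ (he2 m' m hm'.symm)
    · simp
  have hspan : Submodule.span R (Set.range y) = ⊤ := by
    by_contra hne
    have : Nontrivial (LinearMap.ker F ⧸ Submodule.span R (Set.range y)) :=
      Submodule.Quotient.nontrivial_iff.2 hne
    obtain ⟨m, hm, φ, hφ⟩ := exists_hom_ne_zero (R := R)
      (LinearMap.ker F ⧸ Submodule.span R (Set.range y))
    apply hφ
    have := hx ⟨m, hm⟩ (φ.comp (Submodule.mkQ _)) (by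
      intro j
      refine (hy ⟨m, hm⟩ (φ.comp (Submodule.mkQ _)) j).symm.trans ?_
      rw [LinearMap.comp_apply]
      have : (Submodule.span R (Set.range y)).mkQ (y j) = 0 := by
        rw [Submodule.mkQ_apply, Submodule.Quotient.mk_eq_zero]
        exact Submodule.subset_span ⟨j, rfl⟩
      rw [this, map_zero])
    ext c
    exact LinearMap.congr_fun this c
  set φ := Fintype.linearCombination R y with hφ
  have hφs : LinearMap.range φ = ⊤ := by rw [hφ, Fintype.range_linearCombination, hspan]
  obtain ⟨ψ, hψ⟩ := lift_free φ (theta F) (fun v => by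
    have : theta F v ∈ LinearMap.range φ := hφs ▸ Submodule.mem_top
    exact this)
  let T := (LinearMap.ker F).subtype ∘ₗ φ
  have hT : T ∘ₗ ψ = (Nat.card A : R) • LinearMap.id := by
    rw [LinearMap.comp_assoc, hψ]
    rfl
  have hdet := congrArg LinearMap.det hT
  rw [LinearMap.det_comp, det_smul_fin, LinearMap.det_id, mul_one] at hdet
  have hinj : Function.Injective T := by
    rw [← LinearMap.ker_eq_bot, LinearMap.ker_eq_bot']
    intro v hv
    have h1 : LinearMap.det T • v = 0 := by
      have h2 := congrArg (fun M => Matrix.mulVec M v)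
        (Matrix.adjugate_mul (LinearMap.toMatrix' T))
      simp only [← Matrix.mulVec_mulVec, LinearMap.toMatrix'_mulVec, hv, Matrix.mulVec_zero,
        LinearMap.det_toMatrix', Matrix.smul_mulVec, Matrix.one_mulVec] at h2
      exact h2.symm
    ext j
    have h3 := congrFun h1 j
    rw [Pi.smul_apply, smul_eq_mul, Pi.zero_apply] at h3
    refine pow_reg (A := A) hreg r _ ?_
    rw [← hdet, mul_comm (LinearMap.det T), mul_assoc, h3, mul_zero]
  refine ⟨ModuleCat.of R (Fin r → R), ModuleCat.of R (Fin r → R), T, F, ?_, ?_, hinj, hF, ?_⟩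
  · change Module.Projective R (Fin r → R); infer_instance
  · change Module.Projective R (Fin r → R); infer_instance
  · rw [LinearMap.range_comp, hφs, Submodule.map_top, Submodule.range_subtype]

end A
end struct
end FE

open Filter
set_option linter.style.haveILetI false
set_option linter.unusedSectionVars false
namespace FE

section count
variable {R : Type} [CommRing R]

/-- pairs: a surjection `M → A` and a surjection from its kernel to `V` -/
abbrev XX (R A V M : Type) [CommRing R] [AddCommGroup A] [Module R A] [AddCommGroup V] [Module R V]
    [AddCommGroup M] [Module R M] : Type :=
  Σ f : {f : M →ₗ[R] A // Function.Surjective f},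
    {g : LinearMap.ker f.1 →ₗ[R] V // Function.Surjective g}

variable {A V M B : Type} [AddCommGroup A] [Module R A] [AddCommGroup V] [Module R V]
    [AddCommGroup M] [Module R M] [AddCommGroup B] [Module R B]

lemma XX_ext (x y : XX R A V M) (h1 : ∀ m, x.1.1 m = y.1.1 m)
    (h2 : ∀ m hx hy, x.2.1 ⟨m, hx⟩ = y.2.1 ⟨m, hy⟩) : x = y := by
  obtain ⟨⟨f, hf⟩, ⟨g, hg⟩⟩ := x
  obtain ⟨⟨f', hf'⟩, ⟨g', hg'⟩⟩ := y
  obtain rfl : f = f' := LinearMap.ext h1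
  obtain rfl : g = g' := LinearMap.ext fun m => h2 m.1 m.2 m.2
  rfl

def Kof (y : XX R A V M) : Submodule R M := (LinearMap.ker y.2.1).map (LinearMap.ker y.1.1).subtype

lemma mem_Kof (y : XX R A V M) (x : M) :
    x ∈ Kof y ↔ ∃ h : x ∈ LinearMap.ker y.1.1, y.2.1 ⟨x, h⟩ = 0 := by
  constructor
  · rintro ⟨z, hz, rfl⟩
    exact ⟨z.2, hz⟩
  · rintro ⟨h, h'⟩
    exact ⟨⟨x, h⟩, h', rfl⟩

lemma restr_aux (π : M →ₗ[R] B) (f : B →ₗ[R] A) :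
    ∀ x ∈ LinearMap.ker (f ∘ₗ π), π x ∈ LinearMap.ker f := fun _ hx => hx

def pull (π : {π : M →ₗ[R] B // Function.Surjective π}) (x : XX R A V B) : XX R A V M :=
  ⟨⟨x.1.1 ∘ₗ π.1, x.1.2.comp π.2⟩,
    ⟨x.2.1 ∘ₗ π.1.restrict (restr_aux π.1 x.1.1), by
      refine x.2.2.comp ?_
      rintro ⟨b, hb⟩
      obtain ⟨m, rfl⟩ := π.2 b
      exact ⟨⟨m, hb⟩, rfl⟩⟩⟩

lemma factor {X Y Z : Type} [AddCommGroup X] [Module R X] [AddCommGroup Y] [Module R Y]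
    [AddCommGroup Z] [Module R Z] (p : X →ₗ[R] Y) (hp : Function.Surjective p) (g : X →ₗ[R] Z)
    (h : LinearMap.ker p ≤ LinearMap.ker g) : ∃ g' : Y →ₗ[R] Z, ∀ x, g' (p x) = g x := by
  refine ⟨(LinearMap.ker p).liftQ g h ∘ₗ (p.quotKerEquivOfSurjective hp).symm.toLinearMap,
    fun x => ?_⟩
  have : (p.quotKerEquivOfSurjective hp).symm (p x) = Submodule.Quotient.mk x := by
    rw [LinearEquiv.symm_apply_eq]
    rfl
  simp [this]

lemma pull_surj (π : {π : M →ₗ[R] B // Function.Surjective π}) (y : XX R A V M)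
    (h : LinearMap.ker π.1 ≤ Kof y) : ∃ x : XX R A V B, pull π x = y := by
  obtain ⟨f', hf'⟩ := factor π.1 π.2 y.1.1 (fun x hx => ((mem_Kof y x).1 (h hx)).1)
  have hmem : ∀ x ∈ LinearMap.ker y.1.1, π.1 x ∈ LinearMap.ker f' := by
    intro x hx
    rw [LinearMap.mem_ker, hf']
    exact hx
  have hps : Function.Surjective (π.1.restrict hmem) := by
    rintro ⟨b, hb⟩
    obtain ⟨m, rfl⟩ := π.2 b
    refine ⟨⟨m, ?_⟩, rfl⟩
    rw [LinearMap.mem_ker, hf'] at hb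
    exact hb
  obtain ⟨g', hg'⟩ := factor (π.1.restrict hmem) hps y.2.1 (by
    intro x hx
    have : x.1 ∈ LinearMap.ker π.1 := congrArg Subtype.val hx
    exact ((mem_Kof y x).1 (h this)).2)
  have hfs : Function.Surjective f' := by
    intro a
    obtain ⟨m, hm⟩ := y.1.2 a
    exact ⟨π.1 m, by rw [hf', hm]⟩
  have hgs : Function.Surjective g' := by
    intro v
    obtain ⟨m, hm⟩ := y.2.2 v
    exact ⟨π.1.restrict hmem m, by rw [hg', hm]⟩
  refine ⟨⟨⟨f', hfs⟩, ⟨g', hgs⟩⟩, ?_⟩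
  refine XX_ext _ _ (fun m => ?_) (fun m hx hy => ?_)
  · exact hf' m
  · have := hg' ⟨m, hy⟩
    rw [← this]
    rfl

lemma card_ker (f : B →ₗ[R] A) (hf : Function.Surjective f) :
    Nat.card B = Nat.card A * Nat.card (LinearMap.ker f) := by
  rw [Submodule.card_eq_card_quotient_mul_card (LinearMap.ker f), mul_comm,
    Nat.card_congr (f.quotKerEquivOfSurjective hf).toEquiv]

lemma inj_of_card [Finite A] [Finite V] (hB : Nat.card B = Nat.card A * Nat.card V)
    (x : XX R A V B) : Function.Injective x.2.1 := by
  have h1 := card_ker x.1.1 x.1.2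
  rw [hB] at h1
  have h2 : Nat.card V = Nat.card (LinearMap.ker x.1.1) :=
    Nat.eq_of_mul_eq_mul_left Nat.card_pos h1
  have : Finite (LinearMap.ker x.1.1) := Nat.finite_of_card_ne_zero (by
    rw [← h2]; exact Nat.card_pos.ne')
  exact ((Nat.bijective_iff_surjective_and_card _).2 ⟨x.2.2, h2.symm⟩).1

lemma ker_eq_Kof [Finite A] [Finite V] (hB : Nat.card B = Nat.card A * Nat.card V)
    (π : {π : M →ₗ[R] B // Function.Surjective π}) (x : XX R A V B) :
    Kof (pull π x) = LinearMap.ker π.1 := by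
  ext m
  rw [mem_Kof]
  constructor
  · rintro ⟨h, h'⟩
    have h2 : x.2.1 ⟨π.1 m, h⟩ = x.2.1 0 := by rw [map_zero]; exact h'
    exact congrArg Subtype.val (inj_of_card hB x h2)
  · intro h
    have hm : π.1 m = 0 := h
    have h0 : m ∈ LinearMap.ker (pull π x).1.1 := by
      change x.1.1 (π.1 m) = 0
      rw [hm, map_zero]
    refine ⟨h0, ?_⟩
    change x.2.1 ⟨π.1 m, _⟩ = 0
    rw [← map_zero x.2.1]
    congr 1
    exact Subtype.ext hm

lemma fiber_card [Finite A] [Finite V] (hB : Nat.card B = Nat.card A * Nat.card V)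
    (y : XX R A V M) :
    Nat.card {p : {π : M →ₗ[R] B // Function.Surjective π} × XX R A V B // pull p.1 p.2 = y} =
      Nat.card ((M ⧸ Kof y) ≃ₗ[R] B) := by
  have hk : ∀ p : {p : {π : M →ₗ[R] B // Function.Surjective π} × XX R A V B // pull p.1 p.2 = y},
      Kof y = LinearMap.ker p.1.1.1 := fun p => by rw [← ker_eq_Kof hB p.1.1 p.1.2, p.2]
  refine Nat.card_eq_of_bijective
    (fun p => (Submodule.quotEquivOfEq _ _ (hk p)).trans (p.1.1.1.quotKerEquivOfSurjective p.1.1.2))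
    ⟨?_, ?_⟩
  · intro p p' hpp
    have h1 : p.1.1 = p'.1.1 := by
      apply Subtype.ext
      ext m
      exact LinearEquiv.congr_fun hpp (Submodule.Quotient.mk m)
    obtain ⟨⟨π, x⟩, hx⟩ := p
    obtain ⟨⟨π', x'⟩, hx'⟩ := p'
    obtain rfl : π = π' := h1
    have hxx : pull π x = pull π x' := hx.trans hx'.symm
    have h1' : ∀ b, x.1.1 b = x'.1.1 b := by
      intro b
      obtain ⟨m, rfl⟩ := π.2 b
      have : (pull π x).1.1 m = (pull π x').1.1 m := by rw [hxx]
      exact this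
    have h2 : ∀ (z z' : XX R A V M), z = z' → ∀ m hz hz', z.2.1 ⟨m, hz⟩ = z'.2.1 ⟨m, hz'⟩ := by
      rintro z z' rfl m _ _; rfl
    obtain rfl : x = x' := by
      refine XX_ext _ _ h1' fun b hb hb' => ?_
      obtain ⟨m, rfl⟩ := π.2 b
      exact h2 _ _ hxx m hb hb'
    rfl
  · intro e
    let π : {π : M →ₗ[R] B // Function.Surjective π} :=
      ⟨e.toLinearMap ∘ₗ (Kof y).mkQ, e.surjective.comp (Submodule.mkQ_surjective _)⟩
    obtain ⟨x, hx⟩ := pull_surj π y (by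
      intro m hm
      have : e ((Kof y).mkQ m) = 0 := hm
      rw [LinearEquiv.map_eq_zero_iff] at this
      simpa using this)
    refine ⟨⟨⟨π, x⟩, hx⟩, ?_⟩
    ext z
    obtain ⟨m, rfl⟩ := Submodule.mkQ_surjective _ z
    rfl

lemma card_quot_Kof [Finite A] [Finite V] (y : XX R A V M) :
    Nat.card (M ⧸ Kof y) = Nat.card A * Nat.card V := by
  let π : {π : M →ₗ[R] (M ⧸ Kof y) // Function.Surjective π} :=
    ⟨(Kof y).mkQ, Submodule.mkQ_surjective _⟩
  obtain ⟨x, hx⟩ := pull_surj π y (by simp [π])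
  rw [card_ker x.1.1 x.1.2]
  congr 1
  refine Nat.card_eq_of_bijective x.2.1 ⟨?_, x.2.2⟩
  rw [← LinearMap.ker_eq_bot, LinearMap.ker_eq_bot']
  rintro ⟨b, hb⟩ h
  obtain ⟨m, rfl⟩ := π.2 b
  have : m ∈ Kof y := by
    rw [← hx, mem_Kof]
    exact ⟨hb, h⟩
  apply Subtype.ext
  change (Kof y).mkQ m = 0
  simpa using this

lemma finite_XX [IsNoetherianRing R] [Module.Finite R M] [Finite A] [Finite V] :
    Finite (XX R A V M) := by
  have h1 := finite_hom (R := R) M A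
  have h2 : ∀ f : {f : M →ₗ[R] A // Function.Surjective f},
    Finite (LinearMap.ker f.1 →ₗ[R] V) := fun f => finite_hom (R := R) (LinearMap.ker f.1) V
  infer_instance

lemma card_XX_eq_sum [IsNoetherianRing R] [Module.Finite R M] [Finite A] [Finite V]
    (ι : Type) (Mod : ι → ModuleCat.{0} R) (hfin : ∀ i, Finite (Mod i))
    (hcomplete : ∀ (M : Type) [AddCommGroup M] [Module R M],
      Finite M → ∃ i, Nonempty (M ≃ₗ[R] Mod i))
    (hirr : ∀ i j, Nonempty ((Mod i : Type) ≃ₗ[R] Mod j) → i = j)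
    (S : Finset ι) (hS : ∀ i, i ∈ S ↔ Nat.card (Mod i) = Nat.card A * Nat.card V) :
    (Nat.card (XX R A V M) : ℝ) =
      ∑ i ∈ S, ((Nat.card (XX R A V (Mod i)) : ℝ) / numAut R (Mod i)) * numSurj R M (Mod i) := by
  classical
  have hXM := finite_XX (R := R) (A := A) (V := V) (M := M)
  have := Fintype.ofFinite (XX R A V M)
  have h1 : ∀ i ∈ S, ((Nat.card (XX R A V (Mod i)) : ℝ) / numAut R (Mod i)) * numSurj R M (Mod i)
      = ∑ y : XX R A V M, (Nat.card ((M ⧸ Kof y) ≃ₗ[R] Mod i) : ℝ) / numAut R (Mod i) := by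
    intro i hi
    have hB := (hS i).1 hi
    have := hfin i
    have hf1 := finite_hom (R := R) M (Mod i)
    have : Module.Finite R (Mod i) := Module.Finite.of_finite
    have hf2 := finite_XX (R := R) (A := A) (V := V) (M := Mod i)
    have key : numSurj R M (Mod i) * Nat.card (XX R A V (Mod i)) =
        ∑ y : XX R A V M, Nat.card ((M ⧸ Kof y) ≃ₗ[R] Mod i) := by
      unfold numSurj
      rw [← Nat.card_prod, ← Nat.card_congr (Equiv.sigmaFiberEquiv
        (fun p : {π : M →ₗ[R] (Mod i) // Function.Surjective π} × XX R A V (Mod i) =>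
          pull p.1 p.2)), Nat.card_sigma]
      exact Finset.sum_congr rfl fun y _ => fiber_card hB y
    rw [← Finset.sum_div, ← Nat.cast_sum, ← key]
    push_cast
    ring
  rw [Finset.sum_congr rfl h1, Finset.sum_comm, Nat.card_eq_fintype_card]
  have h2 : ∀ y : XX R A V M,
      ∑ i ∈ S, (Nat.card ((M ⧸ Kof y) ≃ₗ[R] Mod i) : ℝ) / numAut R (Mod i) = 1 := by
    intro y
    have hc := card_quot_Kof y
    have : Finite (M ⧸ Kof y) := Nat.finite_of_card_ne_zero (by
      rw [hc]; exact (Nat.mul_pos Nat.card_pos Nat.card_pos).ne')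
    obtain ⟨i, ⟨e⟩⟩ := hcomplete (M ⧸ Kof y) this
    have hi : i ∈ S := by rw [hS, ← hc]; exact (Nat.card_congr e.toEquiv).symm
    rw [Finset.sum_eq_single_of_mem i hi]
    · have : Nat.card ((M ⧸ Kof y) ≃ₗ[R] Mod i) = numAut R (Mod i) :=
        Nat.card_congr ⟨fun f => e.symm.trans f, fun f => e.trans f,
          fun f => by ext; simp, fun f => by ext; simp⟩
      rw [this]
      have := hfin i
      have hF : Finite ((Mod i) ≃ₗ[R] (Mod i)) := Finite.of_injective
        (fun f => (f : Mod i → Mod i)) DFunLike.coe_injective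
      have : 0 < numAut R (Mod i) := by
        unfold numAut
        exact Nat.card_pos (α := (Mod i) ≃ₗ[R] (Mod i))
      exact div_self (by exact_mod_cast this.ne')
    · intro j _ hj
      have : IsEmpty ((M ⧸ Kof y) ≃ₗ[R] Mod j) :=
        ⟨fun f => hj (hirr j i ⟨f.symm.trans e⟩)⟩
      simp
  simp [h2]

lemma card_XX [Fintype {f : M →ₗ[R] A // Function.Surjective f}]
    [hf : ∀ f : {f : M →ₗ[R] A // Function.Surjective f},
      Finite {g : LinearMap.ker f.1 →ₗ[R] V // Function.Surjective g}] :
    Nat.card (XX R A V M) = ∑ f : {f : M →ₗ[R] A // Function.Surjective f},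
      numSurj R (LinearMap.ker f.1) V := by
  rw [Nat.card_sigma]
  rfl

end count
end FE

open Filter
set_option linter.style.haveILetI false
set_option linter.unusedSectionVars false
namespace FE

section schanuel
variable {R : Type} [CommRing R]

lemma card_free_hom (n : ℕ) (B : Type) [AddCommGroup B] [Module R B] :
    Nat.card ((Fin n → R) →ₗ[R] B) = Nat.card B ^ n := by
  rw [← Nat.card_congr ((Pi.basisFun R (Fin n)).constr ℕ (M' := B)).toEquiv, Nat.card_fun,
    Nat.card_fin]

lemma surj_free_tendsto (B : Type) [AddCommGroup B] [Module R B] [Finite B] :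
    Tendsto (fun n : ℕ => (numSurj R (Fin n → R) B : ℝ) / (Nat.card B : ℝ) ^ n) atTop (nhds 1) := by
  classical
  have := Fintype.ofFinite (Submodule R B)
  have hc : (0 : ℝ) < Nat.card B := by exact_mod_cast Nat.card_pos
  have hup : ∀ n : ℕ, numSurj R (Fin n → R) B ≤ Nat.card B ^ n := by
    intro n
    have := finite_hom (R := R) (Fin n → R) B
    rw [← card_free_hom (R := R)]
    exact Nat.card_le_card_of_injective _ Subtype.val_injective
  have hlow : ∀ n : ℕ, Nat.card B ^ n ≤ numSurj R (Fin n → R) B +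
      ∑ W ∈ Finset.univ.filter (fun W : Submodule R B => W ≠ ⊤), Nat.card W ^ n := by
    intro n
    have := finite_hom (R := R) (Fin n → R) B
    rw [← card_free_hom (R := R), ← Nat.card_congr (Equiv.sigmaFiberEquiv
      (fun f : (Fin n → R) →ₗ[R] B => LinearMap.range f)), Nat.card_sigma,
      ← Finset.sum_filter_add_sum_filter_not Finset.univ (fun W : Submodule R B => W = ⊤)]
    refine add_le_add ?_ (Finset.sum_le_sum fun W _ => ?_)
    · rw [Finset.filter_eq' Finset.univ (⊤ : Submodule R B), if_pos (Finset.mem_univ _),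
        Finset.sum_singleton]
      refine (Nat.card_congr (Equiv.subtypeEquivRight fun f => ?_)).le
      exact LinearMap.range_eq_top
    · have hW : Nat.card W ^ n = Nat.card (Fin n → W) := by
        rw [Nat.card_fun, Nat.card_fin]
      rw [hW]
      refine Nat.card_le_card_of_injective (fun f j => ⟨f.1 (Pi.single j 1), by
        have := LinearMap.mem_range_self f.1 (Pi.single j 1)
        rwa [f.2] at this⟩) ?_
      intro f g hfg
      apply Subtype.ext
      refine LinearMap.pi_ext' fun j => LinearMap.ext_ring ?_
      exact congrArg Subtype.val (congrFun hfg j)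
  have h0 : Tendsto (fun n : ℕ => 1 - ∑ W ∈ Finset.univ.filter (fun W : Submodule R B => W ≠ ⊤),
      ((Nat.card W : ℝ) / Nat.card B) ^ n) atTop (nhds (1 - ∑ W ∈ Finset.univ.filter
        (fun W : Submodule R B => W ≠ ⊤), 0)) := by
    refine tendsto_const_nhds.sub (tendsto_finsetSum _ fun W hW => ?_)
    refine tendsto_pow_atTop_nhds_zero_of_lt_one (by positivity) ?_
    rw [div_lt_one hc]
    have hW' := (Finset.mem_filter.1 hW).2
    have h1 : Nat.card W ≤ Nat.card B :=
      Nat.card_le_card_of_injective _ W.injective_subtype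
    refine Nat.cast_lt.2 (lt_of_le_of_ne h1 fun h => hW' ?_)
    have := (Nat.bijective_iff_injective_and_card W.subtype).2 ⟨W.injective_subtype, h⟩
    rw [← W.range_subtype]
    exact LinearMap.range_eq_top.2 this.2
  rw [Finset.sum_const_zero, sub_zero] at h0
  refine tendsto_of_tendsto_of_tendsto_of_le_of_le h0 tendsto_const_nhds (fun n => ?_) (fun n => ?_)
  · have h2 : ((Nat.card B : ℝ)) ^ n ≤ numSurj R (Fin n → R) B +
      ∑ W ∈ Finset.univ.filter (fun W : Submodule R B => W ≠ ⊤), (Nat.card W : ℝ) ^ n := by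
      exact_mod_cast hlow n
    change _ ≤ _ / _
    rw [le_div_iff₀ (by positivity), sub_mul, Finset.sum_mul]
    have : ∀ W : Submodule R B, ((Nat.card W : ℝ) / Nat.card B) ^ n * (Nat.card B : ℝ) ^ n =
      (Nat.card W : ℝ) ^ n := fun W => by
      rw [← mul_pow, div_mul_cancel₀ _ hc.ne']
    simp only [this]
    linarith
  · change _ / _ ≤ (1 : ℝ)
    rw [div_le_one (by positivity)]
    exact_mod_cast hup n

lemma split_pull {X Y A : Type} [AddCommGroup X] [Module R X] [AddCommGroup Y] [Module R Y]
    [AddCommGroup A] [Module R A] (F : X →ₗ[R] A) (G : Y →ₗ[R] A) (s : Y →ₗ[R] X)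
    (hs : ∀ y, F (s y) = G y) :
    Nonempty ((LinearMap.ker F × Y) ≃ₗ[R]
      LinearMap.ker (F ∘ₗ LinearMap.fst R X Y - G ∘ₗ LinearMap.snd R X Y)) := by
  let φ : (LinearMap.ker F × Y) →ₗ[R] X × Y :=
    ((LinearMap.ker F).subtype ∘ₗ LinearMap.fst R _ _ + s ∘ₗ LinearMap.snd R _ _).prod
      (LinearMap.snd R _ _)
  have hφ : ∀ p, φ p = (p.1.1 + s p.2, p.2) := fun p => rfl
  refine ⟨LinearEquiv.ofBijective (φ.codRestrict _ ?_) ⟨?_, ?_⟩⟩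
  · intro p
    have := p.1.2
    rw [LinearMap.mem_ker] at this
    simp [hφ, hs, this]
  · intro p p' h
    have h' : φ p = φ p' := congrArg Subtype.val h
    rw [hφ, hφ] at h'
    have h2 : p.2 = p'.2 := (Prod.ext_iff.1 h').2
    have h1 : p.1.1 + s p.2 = p'.1.1 + s p'.2 := (Prod.ext_iff.1 h').1
    rw [h2] at h1
    exact Prod.ext (Subtype.ext (add_right_cancel h1)) h2
  · rintro ⟨⟨x, y⟩, hxy⟩
    have hxy' : F x = G y := by simpa [sub_eq_zero] using hxy
    refine ⟨(⟨x - s y, by simp [hs, hxy']⟩, y), ?_⟩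
    apply Subtype.ext
    change φ _ = _
    simp [hφ]

lemma swap_pull {X Y A : Type} [AddCommGroup X] [Module R X] [AddCommGroup Y] [Module R Y]
    [AddCommGroup A] [Module R A] (F : X →ₗ[R] A) (G : Y →ₗ[R] A) :
    Nonempty (LinearMap.ker (F ∘ₗ LinearMap.fst R X Y - G ∘ₗ LinearMap.snd R X Y) ≃ₗ[R]
      LinearMap.ker (G ∘ₗ LinearMap.fst R Y X - F ∘ₗ LinearMap.snd R Y X)) := by
  refine ⟨(LinearEquiv.prodComm R X Y).ofSubmodules _ _ ?_⟩
  ext ⟨y, x⟩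
  simp only [Submodule.mem_map_equiv]
  simp only [LinearMap.mem_ker, LinearMap.sub_apply, sub_eq_zero]
  exact eq_comm

lemma card_hom_prod (N Y k : Type) [AddCommGroup N] [Module R N] [AddCommGroup Y] [Module R Y]
    [AddCommGroup k] [Module R k] :
    Nat.card ((N × Y) →ₗ[R] k) = Nat.card (N →ₗ[R] k) * Nat.card (Y →ₗ[R] k) := by
  rw [← Nat.card_prod]
  exact (Nat.card_congr (LinearMap.coprodEquiv ℕ).toEquiv).symm

lemma schanuel_card {A k : Type} [AddCommGroup A] [Module R A] [AddCommGroup k] [Module R k]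
    {r n : ℕ} (F0 : (Fin r → R) →ₗ[R] A) (hF0 : Function.Surjective F0)
    (F : (Fin n → R) →ₗ[R] A) (hF : Function.Surjective F) :
    Nat.card (LinearMap.ker F →ₗ[R] k) * Nat.card k ^ r =
      Nat.card (LinearMap.ker F0 →ₗ[R] k) * Nat.card k ^ n := by
  obtain ⟨s, hs⟩ := lift_free F F0 (fun v => hF (F0 v))
  obtain ⟨s', hs'⟩ := lift_free F0 F (fun v => hF0 (F v))
  obtain ⟨e⟩ := split_pull F F0 s (LinearMap.congr_fun hs)
  obtain ⟨e'⟩ := split_pull F0 F s' (LinearMap.congr_fun hs')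
  obtain ⟨e''⟩ := swap_pull F F0
  have E := (e.trans e'').trans e'.symm
  rw [← card_free_hom (R := R) r k, ← card_free_hom (R := R) n k, ← card_hom_prod,
    ← card_hom_prod]
  exact Nat.card_congr ⟨fun f => f ∘ₗ E.symm.toLinearMap, fun f => f ∘ₗ E.toLinearMap,
    fun f => by ext <;> simp, fun f => by ext <;> simp⟩

lemma surj_count' (m : Ideal R) [hm : m.IsMaximal] [Finite (R ⧸ m)]
    (N : Type) [AddCommGroup N] [Module R N] [Finite (N →ₗ[R] R ⧸ m)] (d : ℕ)
    (hd : Nat.card (N →ₗ[R] R ⧸ m) = Nat.card (R ⧸ m) ^ d) (i : ℕ) :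
    (numSurj R N (Fin i → R ⧸ m) : ℝ) =
        ∏ t ∈ Finset.range i, ((Nat.card (R ⧸ m) : ℝ) ^ d - (Nat.card (R ⧸ m) : ℝ) ^ t) := by
  obtain ⟨d', hd', h⟩ := surj_count m N
  rw [hd] at hd'
  rw [Nat.pow_right_injective (one_lt_card m) hd']
  exact h i

lemma card_VV [Fintype (MaximalSpectrum R)] (i : MaximalSpectrum R → ℕ) :
    Nat.card (VV R i) = ∏ m : MaximalSpectrum R, Nat.card (R ⧸ m.asIdeal) ^ i m := by
  rw [Nat.card_pi]
  refine Finset.prod_congr rfl fun m _ => ?_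
  rw [Nat.card_fun, Nat.card_fin]

variable [IsNoetherianRing R] [Fintype (MaximalSpectrum R)]
  [∀ m : MaximalSpectrum R, Finite (R ⧸ m.asIdeal)]
  {A : Type} [AddCommGroup A] [Module R A] [Finite A] {r : ℕ}

lemma card_XX_free
    (F0 : (Fin r → R) →ₗ[R] A) (hF0 : Function.Surjective F0) (a : MaximalSpectrum R → ℕ)
    (ha : ∀ m : MaximalSpectrum R, Nat.card (LinearMap.ker F0 →ₗ[R] R ⧸ m.asIdeal) =
      Nat.card (R ⧸ m.asIdeal) ^ (r + a m))
    (i : MaximalSpectrum R → ℕ) (n : ℕ) :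
    (Nat.card (XX R A (VV R i) (Fin n → R)) : ℝ) = numSurj R (Fin n → R) A *
      ∏ m : MaximalSpectrum R, ∏ t ∈ Finset.range (i m),
        ((Nat.card (R ⧸ m.asIdeal) : ℝ) ^ (n + a m) - (Nat.card (R ⧸ m.asIdeal) : ℝ) ^ t) := by
  have := finite_hom (R := R) (Fin n → R) A
  have := Fintype.ofFinite {f : (Fin n → R) →ₗ[R] A // Function.Surjective f}
  have hf : ∀ f : {f : (Fin n → R) →ₗ[R] A // Function.Surjective f},
    Finite {g : LinearMap.ker f.1 →ₗ[R] VV R i // Function.Surjective g} := fun f => by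
      have := finite_hom (R := R) (LinearMap.ker f.1) (VV R i)
      infer_instance
  rw [card_XX, Nat.cast_sum]
  have key : ∀ f : {f : (Fin n → R) →ₗ[R] A // Function.Surjective f},
      (numSurj R (LinearMap.ker f.1) (VV R i) : ℝ) =
      ∏ m : MaximalSpectrum R, ∏ t ∈ Finset.range (i m),
        ((Nat.card (R ⧸ m.asIdeal) : ℝ) ^ (n + a m) - (Nat.card (R ⧸ m.asIdeal) : ℝ) ^ t) := by
    intro f
    rw [numSurj_VV, Nat.cast_prod]
    refine Finset.prod_congr rfl fun m _ => ?_
    have hm := m.isMaximal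
    have := finite_hom (R := R) (LinearMap.ker f.1) (R ⧸ m.asIdeal)
    refine surj_count' m.asIdeal _ _ ?_ _
    have h := schanuel_card (k := R ⧸ m.asIdeal) F0 hF0 f.1 f.2
    rw [ha] at h
    have h1 : 0 < Nat.card (R ⧸ m.asIdeal) ^ r := pow_pos (Nat.card_pos) _
    refine Nat.eq_of_mul_eq_mul_right h1 (h.trans ?_)
    rw [← pow_add, ← pow_add]
    congr 1
    omega
  rw [Finset.sum_congr rfl fun f _ => key f, Finset.sum_const, nsmul_eq_mul, numSurj,
    Finset.card_univ, Nat.card_eq_fintype_card]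

lemma sum_w
    (F0 : (Fin r → R) →ₗ[R] A) (hF0 : Function.Surjective F0) (a : MaximalSpectrum R → ℕ)
    (ha : ∀ m : MaximalSpectrum R, Nat.card (LinearMap.ker F0 →ₗ[R] R ⧸ m.asIdeal) =
      Nat.card (R ⧸ m.asIdeal) ^ (r + a m))
    (ι : Type) (Mod : ι → ModuleCat.{0} R) (hfin : ∀ i, Finite (Mod i))
    (hcomplete : ∀ (M : Type) [AddCommGroup M] [Module R M],
      Finite M → ∃ i, Nonempty (M ≃ₗ[R] Mod i))
    (hirr : ∀ i j, Nonempty ((Mod i : Type) ≃ₗ[R] Mod j) → i = j)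
    (i : MaximalSpectrum R → ℕ)
    (S : Finset ι) (hS : ∀ j, j ∈ S ↔ Nat.card (Mod j) = Nat.card A * Nat.card (VV R i)) :
    ∑ j ∈ S, ((Nat.card (XX R A (VV R i) (Mod j)) : ℝ) / numAut R (Mod j)) =
      ∏ m : MaximalSpectrum R, (Nat.card (R ⧸ m.asIdeal) : ℝ) ^ (a m * i m) := by
  set c : ℝ := (Nat.card A : ℝ) * Nat.card (VV R i) with hc
  have hq : ∀ m : MaximalSpectrum R, (1 : ℝ) < Nat.card (R ⧸ m.asIdeal) := fun m => by
    have hm := m.isMaximal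
    exact_mod_cast one_lt_card m.asIdeal
  have hA : (0 : ℝ) < Nat.card A := by exact_mod_cast Nat.card_pos
  have l1 : Tendsto (fun n : ℕ => (Nat.card (XX R A (VV R i) (Fin n → R)) : ℝ) / c ^ n) atTop
      (nhds (∑ j ∈ S, ((Nat.card (XX R A (VV R i) (Mod j)) : ℝ) / numAut R (Mod j)) * 1)) := by
    have : ∀ n : ℕ, (Nat.card (XX R A (VV R i) (Fin n → R)) : ℝ) / c ^ n = 
        ∑ j ∈ S, ((Nat.card (XX R A (VV R i) (Mod j)) : ℝ) / numAut R (Mod j)) *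
          ((numSurj R (Fin n → R) (Mod j) : ℝ) / (Nat.card (Mod j) : ℝ) ^ n) := by
      intro n
      rw [card_XX_eq_sum ι Mod hfin hcomplete hirr S hS, Finset.sum_div]
      refine Finset.sum_congr rfl fun j hj => ?_
      rw [(hS j).1 hj, hc]
      push_cast
      ring
    simp only [this]
    refine tendsto_finsetSum _ fun j _ => ?_
    have := hfin j
    exact (surj_free_tendsto (R := R) (Mod j)).const_mul _
  have l2 : Tendsto (fun n : ℕ => (Nat.card (XX R A (VV R i) (Fin n → R)) : ℝ) / c ^ n) atTop
      (nhds (1 * ∏ m : MaximalSpectrum R, ∏ t ∈ Finset.range (i m),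
        ((Nat.card (R ⧸ m.asIdeal) : ℝ) ^ a m - 0))) := by
    have : ∀ n : ℕ, (Nat.card (XX R A (VV R i) (Fin n → R)) : ℝ) / c ^ n = 
        ((numSurj R (Fin n → R) A : ℝ) / (Nat.card A : ℝ) ^ n) *
        ∏ m : MaximalSpectrum R, ∏ t ∈ Finset.range (i m),
        ((Nat.card (R ⧸ m.asIdeal) : ℝ) ^ a m - (Nat.card (R ⧸ m.asIdeal) : ℝ) ^ t *
          ((Nat.card (R ⧸ m.asIdeal) : ℝ)⁻¹) ^ n) := by
      intro n
      rw [card_XX_free F0 hF0 a ha, hc, card_VV, mul_pow, mul_div_mul_comm]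
      congr 1
      rw [Nat.cast_prod, ← Finset.prod_pow, ← Finset.prod_div_distrib]
      refine Finset.prod_congr rfl fun m _ => ?_
      have h0 : (Nat.card (R ⧸ m.asIdeal) : ℝ) ≠ 0 := by linarith [hq m]
      rw [div_eq_iff (pow_ne_zero _ (by exact_mod_cast pow_ne_zero _ h0))]
      have : ((Nat.card (R ⧸ m.asIdeal) ^ i m : ℕ) : ℝ) ^ n =
          ∏ t ∈ Finset.range (i m), (Nat.card (R ⧸ m.asIdeal) : ℝ) ^ n := by
        rw [Finset.prod_const, Finset.card_range]
        push_cast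
        rw [← pow_mul, ← pow_mul, mul_comm]
      rw [this, ← Finset.prod_mul_distrib]
      refine Finset.prod_congr rfl fun t _ => ?_
      rw [sub_mul, inv_pow, mul_assoc, inv_mul_cancel₀ (pow_ne_zero _ h0), mul_one, ← pow_add,
        add_comm]
    simp only [this]
    refine (surj_free_tendsto (R := R) A).mul (tendsto_finsetProd _ fun m _ =>
      tendsto_finsetProd _ fun t _ => tendsto_const_nhds.sub ?_)
    have h := (tendsto_pow_atTop_nhds_zero_of_lt_one (r := (Nat.card (R ⧸ m.asIdeal) : ℝ)⁻¹)
      (by positivity) (inv_lt_one_of_one_lt₀ (hq m))).const_mul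
      ((Nat.card (R ⧸ m.asIdeal) : ℝ) ^ t)
    simpa using h
  have h := tendsto_nhds_unique l1 l2
  simp only [mul_one, one_mul, sub_zero, Finset.prod_const, Finset.card_range] at h
  rw [h]
  exact Finset.prod_congr rfl fun m _ => by rw [pow_mul]

end schanuel
end FE

open Filter
set_option linter.style.haveILetI false
set_option linter.unusedSectionVars false
namespace FE

section pointwise
variable {R : Type} [CommRing R]

/-- cardinality of the residue field -/
noncomputable def qq (m : MaximalSpectrum R) : ℝ := (Nat.card (R ⧸ m.asIdeal) : ℝ)

noncomputable def PPi [Fintype (MaximalSpectrum R)] (i : MaximalSpectrum R → ℕ) : ℝ :=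
  ∏ m, piq (qq m) (i m)

noncomputable def Gam [Fintype (MaximalSpectrum R)] (a i : MaximalSpectrum R → ℕ) : ℝ :=
  ∏ m, gam (qq m) (a m) (i m)

noncomputable def sg [Fintype (MaximalSpectrum R)] (i : MaximalSpectrum R → ℕ) : ℝ :=
  ∏ m, (-1) ^ (i m)

open scoped Classical in
noncomputable def iT (s : ℕ) (T : Finset (MaximalSpectrum R)) : MaximalSpectrum R → ℕ :=
  fun m => if m ∈ T then s else 0

open scoped Classical in
noncomputable def Box (R : Type) [CommRing R] [Fintype (MaximalSpectrum R)] (s : ℕ) :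
    Finset (MaximalSpectrum R → ℕ) :=
  Fintype.piFinset fun _ => Finset.range (s + 1)

open scoped Classical in
noncomputable def Tz (R : Type) [CommRing R] [Fintype (MaximalSpectrum R)] :
    Finset (Finset (MaximalSpectrum R)) :=
  (Finset.univ : Finset (MaximalSpectrum R)).powerset.erase ∅

variable [Fintype (MaximalSpectrum R)]

lemma box_prod (s : ℕ) (g : MaximalSpectrum R → ℕ → ℝ) :
    ∏ m, ∑ i ∈ Finset.range (s + 1), (-1) ^ i * g m i = ∑ i ∈ Box R s, sg i * ∏ m, g m (i m) := by
  classical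
  rw [Finset.prod_univ_sum, Box]
  simp only [Finset.prod_mul_distrib, sg]

lemma tz_prod (s : ℕ) (g : MaximalSpectrum R → ℕ → ℝ) (hg : ∀ m, g m 0 = 1) :
    ∏ m, (1 + g m s) - 1 = ∑ T ∈ Tz R, ∏ m, g m (iT s T m) := by
  classical
  have h : ∀ T : Finset (MaximalSpectrum R), ∏ m, g m (iT s T m) = ∏ m ∈ T, g m s := by
    intro T
    rw [← Finset.prod_subset (Finset.subset_univ T)]
    · exact Finset.prod_congr rfl fun m hm => by simp [iT, hm]
    · intro m _ hm
      simp [iT, hm, hg]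
  simp only [h]
  rw [Finset.prod_one_add, Tz, sub_eq_iff_eq_add]
  have := Finset.sum_erase_add (Finset.univ : Finset (MaximalSpectrum R)).powerset
    (fun T => ∏ m ∈ T, g m s) (a := ∅) (Finset.empty_mem_powerset _)
  rw [Finset.prod_empty] at this
  rw [← this]

lemma iT_mem (s : ℕ) (T : Finset (MaximalSpectrum R)) : iT s T ∈ Box R s := by
  classical
  rw [Box, Fintype.mem_piFinset]
  intro m
  unfold iT
  split_ifs <;> simp

variable [IsNoetherianRing R] [hfinq : ∀ m : MaximalSpectrum R, Finite (R ⧸ m.asIdeal)]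

lemma one_lt_qq (m : MaximalSpectrum R) : 1 < qq m := by
  have hm := m.isMaximal
  unfold qq
  exact_mod_cast one_lt_card m.asIdeal

lemma PPi_pos (i : MaximalSpectrum R → ℕ) : 0 < PPi i :=
  Finset.prod_pos fun m _ => piq_pos (one_lt_qq m) _

lemma ker_bound (K : Type) [AddCommGroup K] [Module R K] [Finite K] (s : ℕ) (δ : ℝ)
    [Decidable (Subsingleton K)]
    (hδ : δ = if Subsingleton K then 1 else 0) :
    |δ - ∑ i ∈ Box R s, sg i * ((numSurj R K (VV R i) : ℝ) / PPi i)| ≤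
      ∑ T ∈ Tz R, (numSurj R K (VV R (iT s T)) : ℝ) / PPi (iT s T) := by
  classical
  have : Module.Finite R K := Module.Finite.of_finite
  have hfh : ∀ m : MaximalSpectrum R, Finite (K →ₗ[R] R ⧸ m.asIdeal) := fun m =>
    finite_hom (R := R) K (R ⧸ m.asIdeal)
  have hd : ∀ m : MaximalSpectrum R, ∃ d : ℕ,
      Nat.card (K →ₗ[R] R ⧸ m.asIdeal) = Nat.card (R ⧸ m.asIdeal) ^ d := fun m => by
    have hm := m.isMaximal
    obtain ⟨d, hd, -⟩ := surj_count m.asIdeal K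
    exact ⟨d, hd⟩
  choose d hd using hd
  have hV : ∀ i, (numSurj R K (VV R i) : ℝ) / PPi i = ∏ m, rho (qq m) (qq m ^ d m) (i m) := by
    intro i
    rw [numSurj_VV, PPi, Nat.cast_prod, ← Finset.prod_div_distrib]
    refine Finset.prod_congr rfl fun m _ => ?_
    have hm := m.isMaximal
    rw [surj_count' m.asIdeal K (d m) (hd m)]
    rfl
  simp only [hV]
  rw [← box_prod s (fun m => rho (qq m) (qq m ^ d m)),
    ← tz_prod s (fun m => rho (qq m) (qq m ^ d m)) (fun m => by simp [rho, piq])]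
  have hδ' : δ = ∏ m, if d m = 0 then (1 : ℝ) else 0 := by
    rw [hδ]
    split_ifs with hK
    · symm
      refine Finset.prod_eq_one fun m _ => if_pos ?_
      have hm := m.isMaximal
      have h1 : Nat.card (K →ₗ[R] R ⧸ m.asIdeal) = 1 := by
        have : Subsingleton (K →ₗ[R] R ⧸ m.asIdeal) :=
          ⟨fun f g => LinearMap.ext fun x => by rw [Subsingleton.elim x 0, map_zero, map_zero]⟩
        exact Nat.card_of_subsingleton 0
      rw [hd m] at h1
      by_contra h0
      exact (one_lt_pow₀ (one_lt_card m.asIdeal) h0).ne' h1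
    · have : Nontrivial K := not_subsingleton_iff_nontrivial.1 hK
      obtain ⟨m, hm, φ, hφ⟩ := exists_hom_ne_zero (R := R) K
      symm
      refine Finset.prod_eq_zero (Finset.mem_univ ⟨m, hm⟩) (if_neg fun h0 => ?_)
      have h1 := hd ⟨m, hm⟩
      rw [h0, pow_zero] at h1
      have := (Nat.card_eq_one_iff_unique.1 h1).1
      exact hφ (Subsingleton.elim _ _)
  rw [hδ']
  refine prod_sub_bound _ _ _ _ (fun m => ?_) (fun m => rho_bound (one_lt_qq m) (d m) s)
  split_ifs <;> simp

lemma iso_bound (A M : Type) [AddCommGroup A] [Module R A] [Finite A]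
    [AddCommGroup M] [Module R M] [Finite M] (s : ℕ) :
    |(Nat.card (M ≃ₗ[R] A) : ℝ) -
      ∑ i ∈ Box R s, sg i * ((Nat.card (XX R A (VV R i) M) : ℝ) / PPi i)| ≤
      ∑ T ∈ Tz R, (Nat.card (XX R A (VV R (iT s T)) M) : ℝ) / PPi (iT s T) := by
  classical
  have : Module.Finite R M := Module.Finite.of_finite
  have := finite_hom (R := R) M A
  have := Fintype.ofFinite {f : M →ₗ[R] A // Function.Surjective f}
  have hf : ∀ i, ∀ f : {f : M →ₗ[R] A // Function.Surjective f},
    Finite {g : LinearMap.ker f.1 →ₗ[R] VV R i // Function.Surjective g} := fun i f => by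
      have := finite_hom (R := R) (LinearMap.ker f.1) (VV R i)
      infer_instance
  have h1 : (Nat.card (M ≃ₗ[R] A) : ℝ) = ∑ f : {f : M →ₗ[R] A // Function.Surjective f},
      if Subsingleton (LinearMap.ker f.1) then (1 : ℝ) else 0 := by
    rw [Finset.sum_boole, ← Fintype.card_subtype, ← Nat.card_eq_fintype_card]
    congr 1
    refine Nat.card_eq_of_bijective (fun e => ⟨⟨e.toLinearMap, e.surjective⟩, ?_⟩) ⟨?_, ?_⟩
    · rw [LinearEquiv.ker]
      infer_instance
    · intro e e' h
      ext x
      exact LinearMap.congr_fun (congrArg Subtype.val (congrArg Subtype.val h)) x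
    · rintro ⟨⟨f, hf⟩, hK⟩
      refine ⟨LinearEquiv.ofBijective f ⟨?_, hf⟩, rfl⟩
      rw [← LinearMap.ker_eq_bot]
      exact (Submodule.subsingleton_iff_eq_bot).1 hK
  have h2 : ∀ i, (Nat.card (XX R A (VV R i) M) : ℝ) =
      ∑ f : {f : M →ₗ[R] A // Function.Surjective f},
        (numSurj R (LinearMap.ker f.1) (VV R i) : ℝ) := by
    intro i
    have := hf i
    rw [card_XX, Nat.cast_sum]
  simp only [h1, h2, Finset.sum_div, Finset.mul_sum]
  rw [Finset.sum_comm, Finset.sum_comm (s := Tz R), ← Finset.sum_sub_distrib]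
  refine (Finset.abs_sum_le_sum_abs _ _).trans (Finset.sum_le_sum fun f _ => ?_)
  exact ker_bound (LinearMap.ker f.1) s _ rfl

end pointwise
end FE

open Filter
set_option linter.style.haveILetI false
set_option linter.unusedSectionVars false
namespace FE

section main
variable {R : Type} [CommRing R] [Fintype (MaximalSpectrum R)]
  [IsNoetherianRing R] [hfinq : ∀ m : MaximalSpectrum R, Finite (R ⧸ m.asIdeal)]

lemma Gam_eq (a i : MaximalSpectrum R → ℕ) :
    Gam a i = (∏ m : MaximalSpectrum R, (Nat.card (R ⧸ m.asIdeal) : ℝ) ^ (a m * i m)) / PPi i := by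
  rw [Gam, PPi, ← Finset.prod_div_distrib]
  rfl

lemma Gam_pos (a i : MaximalSpectrum R → ℕ) : 0 < Gam a i :=
  Finset.prod_pos fun m _ => gam_pos (one_lt_qq m) _ _

lemma nu_bound (ι : Type) (Mod : ι → ModuleCat.{0} R) (hfin : ∀ i, Finite (Mod i))
    (hcomplete : ∀ (M : Type) [AddCommGroup M] [Module R M],
      Finite M → ∃ i, Nonempty (M ≃ₗ[R] Mod i))
    (hirr : ∀ i j, Nonempty ((Mod i : Type) ≃ₗ[R] Mod j) → i = j)
    (i0 : ι) {r : ℕ}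
    (F0 : (Fin r → R) →ₗ[R] (Mod i0)) (hF0 : Function.Surjective F0) (a : MaximalSpectrum R → ℕ)
    (ha : ∀ m : MaximalSpectrum R, Nat.card (LinearMap.ker F0 →ₗ[R] R ⧸ m.asIdeal) =
      Nat.card (R ⧸ m.asIdeal) ^ (r + a m)) (s : ℕ) (δ : ℝ) (S' : Finset ι)
    (Sf : ℕ → Finset ι) (hSf : ∀ c j, j ∈ Sf c ↔ Nat.card (Mod j) = c)
    (hS' : ∀ i ∈ Box R s, Sf (Nat.card (Mod i0) * Nat.card (VV R i)) ⊆ S')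
    (ν : ι → ℝ) (hν : ∀ i, 0 ≤ ν i)
    (hmom : ∀ i' ∈ S', ∃ t : ℝ,
          HasSum (fun i => ν i * (numSurj R (Mod i) (Mod i') : ℝ)) t ∧
          1 - δ ≤ t ∧ t ≤ 1 + δ) :
    |ν i0 * numAut R (Mod i0) - ∏ m : MaximalSpectrum R,
        ∑ i ∈ Finset.range (s + 1), (-1) ^ i * gam (qq m) (a m) i| ≤
      δ * (∑ i ∈ Box R s, Gam a i) +
        (1 + δ) * (∏ m : MaximalSpectrum R, (1 + gam (qq m) (a m) s) - 1) := by
  classical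
  have hfi := hfin i0
  have hH : ∀ i ∈ Box R s, ∃ H : ℝ, HasSum (fun j => ν j *
      ((Nat.card (XX R (Mod i0) (VV R i) (Mod j)) : ℝ) / PPi i)) H ∧ |H - Gam a i| ≤ δ * Gam a i := by
    intro i hi
    have hsub := hS' i hi
    set S := Sf (Nat.card (Mod i0) * Nat.card (VV R i)) with hSdef
    have hS := hSf (Nat.card (Mod i0) * Nat.card (VV R i))
    rw [← hSdef] at hS
    have hw := sum_w F0 hF0 a ha ι Mod hfin hcomplete hirr i S hS
    set w : ι → ℝ := fun j => (Nat.card (XX R (Mod i0) (VV R i) (Mod j)) : ℝ) / numAut R (Mod j)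
      with hwdef
    have hw0 : ∀ j, 0 ≤ w j := fun j => by positivity
    choose! t ht htl htu using hmom
    refine ⟨(∑ k ∈ S, w k * t k) / PPi i, ?_, ?_⟩
    · have h1 : HasSum (fun j => ∑ k ∈ S, w k * (ν j * (numSurj R (Mod j) (Mod k) : ℝ)))
        (∑ k ∈ S, w k * t k) := hasSum_sum fun k hk => (ht k (hsub hk)).mul_left (w k)
      refine (h1.div_const (PPi i)).congr_fun ?_ 
      intro j
      have := hfin j
      have : Module.Finite R (Mod j) := Module.Finite.of_finite
      rw [card_XX_eq_sum (M := Mod j) ι Mod hfin hcomplete hirr S hS, ← mul_div_assoc,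
        Finset.mul_sum]
      congr 1
      refine Finset.sum_congr rfl fun k _ => ?_
      simp only [hwdef]
      ring
    · have hP := PPi_pos i
      rw [Gam_eq, ← hw, ← sub_div, ← mul_div_assoc, abs_div, abs_of_pos hP, Finset.mul_sum,
        ← Finset.sum_sub_distrib]
      refine div_le_div_of_nonneg_right ?_ hP.le
      refine (Finset.abs_sum_le_sum_abs _ _).trans (Finset.sum_le_sum fun k hk => ?_)
      have h1 := htl k (hsub hk)
      have h2 := htu k (hsub hk)
      have h3 : w k * t k - w k = w k * (t k - 1) := by ring
      change |w k * t k - w k| ≤ δ * w k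
      rw [h3, abs_mul, abs_of_nonneg (hw0 k), mul_comm]
      refine mul_le_mul_of_nonneg_right ?_ (hw0 k)
      rw [abs_le]
      constructor <;> linarith
  choose! H hHs hHb using hH
  have hiso : HasSum (fun j => ν j * (Nat.card ((Mod j) ≃ₗ[R] (Mod i0)) : ℝ))
      (ν i0 * numAut R (Mod i0)) := by
    refine hasSum_single i0 fun j hj => ?_
    have : IsEmpty ((Mod j) ≃ₗ[R] (Mod i0)) := ⟨fun e => hj (hirr _ _ ⟨e⟩)⟩
    simp
  have hD : HasSum (fun j => ν j * ((Nat.card ((Mod j) ≃ₗ[R] (Mod i0)) : ℝ) -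
      ∑ i ∈ Box R s, sg i * ((Nat.card (XX R (Mod i0) (VV R i) (Mod j)) : ℝ) / PPi i)))
      (ν i0 * numAut R (Mod i0) - ∑ i ∈ Box R s, sg i * H i) := by
    refine (hiso.sub (hasSum_sum fun i hi => (hHs i hi).mul_left (sg i))).congr_fun ?_
    intro j
    rw [mul_sub, Finset.mul_sum]
    congr 1
    exact Finset.sum_congr rfl fun i _ => by ring
  have hE : HasSum (fun j => ν j *
      (∑ T ∈ Tz R, (Nat.card (XX R (Mod i0) (VV R (iT s T)) (Mod j)) : ℝ) / PPi (iT s T)))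
      (∑ T ∈ Tz R, H (iT s T)) := by
    refine (hasSum_sum fun T hT => hHs (iT s T) (iT_mem s T)).congr_fun ?_
    intro j
    rw [Finset.mul_sum]
  have hDE : |ν i0 * numAut R (Mod i0) - ∑ i ∈ Box R s, sg i * H i| ≤ ∑ T ∈ Tz R, H (iT s T) := by
    have hb : ∀ j, _ := fun j => by
      have := hfin j
      exact iso_bound (R := R) (Mod i0) (Mod j) s
    rw [abs_le]
    constructor
    · refine hasSum_le (fun j => ?_) hE.neg hD
      have := mul_le_mul_of_nonneg_left (abs_le.1 (hb j)).1 (hν j)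
      rw [mul_neg] at this
      exact this
    · refine hasSum_le (fun j => ?_) hD hE
      exact mul_le_mul_of_nonneg_left (abs_le.1 (hb j)).2 (hν j)
  have hsg : ∀ i : MaximalSpectrum R → ℕ, |sg i| = 1 := fun i => by
    rw [sg, Finset.abs_prod]
    exact Finset.prod_eq_one fun m _ => by simp
  rw [box_prod s (fun m => gam (qq m) (a m)), tz_prod s (fun m => gam (qq m) (a m))
    (fun m => by simp [gam, piq])]
  change |_ - ∑ i ∈ Box R s, sg i * Gam a i| ≤ _ + (1 + δ) * ∑ T ∈ Tz R, Gam a (iT s T)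
  have h1 : |∑ i ∈ Box R s, sg i * H i - ∑ i ∈ Box R s, sg i * Gam a i| ≤
      δ * ∑ i ∈ Box R s, Gam a i := by
    rw [← Finset.sum_sub_distrib, Finset.mul_sum]
    refine (Finset.abs_sum_le_sum_abs _ _).trans (Finset.sum_le_sum fun i hi => ?_)
    rw [← mul_sub, abs_mul, hsg, one_mul]
    exact hHb i hi
  have h2 : ∑ T ∈ Tz R, H (iT s T) ≤ (1 + δ) * ∑ T ∈ Tz R, Gam a (iT s T) := by
    rw [Finset.mul_sum]
    refine Finset.sum_le_sum fun T _ => ?_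
    have := (abs_le.1 (hHb _ (iT_mem s T))).2
    linarith
  have h3 := abs_sub_le (ν i0 * numAut R (Mod i0)) (∑ i ∈ Box R s, sg i * H i)
    (∑ i ∈ Box R s, sg i * Gam a i)
  linarith

lemma per_module (hreg : ∀ c : ℕ, c ≠ 0 → ∀ x : R, (c : R) * x = 0 → x = 0)
    (ι : Type) (Mod : ι → ModuleCat.{0} R) (hfin : ∀ i, Finite (Mod i))
    (hcomplete : ∀ (M : Type) [AddCommGroup M] [Module R M],
      Finite M → ∃ i, Nonempty (M ≃ₗ[R] Mod i))
    (hirr : ∀ i j, Nonempty ((Mod i : Type) ≃ₗ[R] Mod j) → i = j)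
    (Sf : ℕ → Finset ι) (hSf : ∀ c j, j ∈ Sf c ↔ Nat.card (Mod j) = c)
    (i0 : ι) (ε : ℝ) (hε : 0 < ε) :
    ∃ δ : ℝ, 0 < δ ∧ ∃ S' : Finset ι, ∀ ν : ι → ℝ, (∀ i, 0 ≤ ν i) →
        (∀ i' ∈ S', ∃ t : ℝ,
          HasSum (fun i => ν i * (numSurj R (Mod i) (Mod i') : ℝ)) t ∧
          1 - δ ≤ t ∧ t ≤ 1 + δ) → |ν i0 - muCL R ι Mod i0| < ε := by
  classical
  have hfi := hfin i0
  have : Module.Finite R (Mod i0) := Module.Finite.of_finite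
  obtain ⟨r, F0, hF0⟩ := Module.Finite.exists_fin' R (Mod i0)
  have hex : ∀ m : MaximalSpectrum R, ∃ a : ℕ,
      Nat.card (LinearMap.ker F0 →ₗ[R] R ⧸ m.asIdeal) = Nat.card (R ⧸ m.asIdeal) ^ (r + a) := by
    intro m
    have hm := m.isMaximal
    have := finite_hom (R := R) (LinearMap.ker F0) (R ⧸ m.asIdeal)
    obtain ⟨d, hd, -⟩ := surj_count m.asIdeal (LinearMap.ker F0)
    have := rank_ge F0 hreg m.asIdeal d hd
    exact ⟨d - r, by rw [hd]; congr 1; omega⟩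
  choose a ha using hex
  set L : ℝ := ∏ m : MaximalSpectrum R,
    (if a m = 0 then ∏' i : ℕ, (1 - (qq m)⁻¹ ^ (i + 1)) else 0) with hL
  have hF : Finite ((Mod i0) ≃ₗ[R] (Mod i0)) := Finite.of_injective
    (fun f => (f : Mod i0 → Mod i0)) DFunLike.coe_injective
  have hAut : 0 < numAut R (Mod i0) := by
    unfold numAut
    exact Nat.card_pos (α := (Mod i0) ≃ₗ[R] (Mod i0))
  have hAut1 : (1 : ℝ) ≤ numAut R (Mod i0) := by exact_mod_cast hAut
  have hmu : muCL R ι Mod i0 = L / numAut R (Mod i0) := by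
    unfold muCL
    split_ifs with hpd
    · have hz : ∀ m, a m = 0 := by
        intro m
        have hm := m.isMaximal
        have := rank_le F0 hreg m.asIdeal _ (ha m) (ker_projective F0 hF0 hpd)
        omega
      rw [hL, cProd, finprod_eq_prod_of_fintype]
      congr 1
      refine Finset.prod_congr rfl fun m _ => ?_
      rw [if_pos (hz m)]
      rfl
    · have hz : ∃ m, a m ≠ 0 := by
        by_contra hn
        push Not at hn
        refine hpd (pd_of_ranks F0 hreg hF0 fun m => ?_)
        rw [ha, hn, add_zero]
      obtain ⟨m, hm⟩ := hz
      rw [hL, Finset.prod_eq_zero (Finset.mem_univ m) (if_neg hm), zero_div]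
  have t1 : Tendsto (fun s : ℕ => ∏ m : MaximalSpectrum R,
      ∑ i ∈ Finset.range (s + 1), (-1) ^ i * gam (qq m) (a m) i) atTop (nhds L) :=
    tendsto_finsetProd _ fun m _ => gam_sum_tendsto (one_lt_qq m) (a m)
  have t2 : Tendsto (fun s : ℕ => ∏ m : MaximalSpectrum R, (1 + gam (qq m) (a m) s) - 1) atTop
      (nhds 0) := by
    have : Tendsto (fun s : ℕ => ∏ m : MaximalSpectrum R, (1 + gam (qq m) (a m) s) - 1) atTop
      (nhds (∏ m : MaximalSpectrum R, (1 + 0 : ℝ) - 1)) :=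
      (tendsto_finsetProd _ fun m _ =>
        tendsto_const_nhds.add (gam_tendsto (one_lt_qq m) (a m))).sub tendsto_const_nhds
    simpa using this
  have e1 := Metric.tendsto_nhds.1 t1 (ε / 3) (by positivity)
  have e2 := t2.eventually (gt_mem_nhds (show (0 : ℝ) < ε / 6 by positivity))
  obtain ⟨s, hs1, hs2⟩ := (e1.and e2).exists
  rw [Real.dist_eq] at hs1
  set G : ℝ := ∑ i ∈ Box R s, Gam a i with hG
  have hG0 : 0 ≤ G := Finset.sum_nonneg fun i _ => (Gam_pos a i).le
  have hδ0 : 0 < min 1 (ε / 3 / (G + 1)) := lt_min one_pos (by positivity)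
  refine ⟨min 1 (ε / 3 / (G + 1)), hδ0,
    (Box R s).biUnion fun i => Sf (Nat.card (Mod i0) * Nat.card (VV R i)), fun ν hν hmom => ?_⟩
  have hb := nu_bound ι Mod hfin hcomplete hirr i0 F0 hF0 a ha s _ _ Sf hSf
    (fun i hi => Finset.subset_biUnion_of_mem
      (fun i => Sf (Nat.card (Mod i0) * Nat.card (VV R i))) hi) ν hν hmom
  rw [← hG] at hb
  set δ := min 1 (ε / 3 / (G + 1)) with hδ
  have hδ1 : δ ≤ 1 := min_le_left _ _
  have hδG : δ * G ≤ ε / 3 := by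
    have h1 : δ ≤ ε / 3 / (G + 1) := min_le_right _ _
    rw [le_div_iff₀ (by linarith)] at h1
    nlinarith
  set E := ∏ m : MaximalSpectrum R, (1 + gam (qq m) (a m) s) - 1 with hE
  have hE0 : 0 ≤ E := by
    rw [hE, sub_nonneg]
    have h := Finset.prod_le_prod (s := (Finset.univ : Finset (MaximalSpectrum R)))
      (f := fun _ => (1 : ℝ)) (g := fun m => 1 + gam (qq m) (a m) s) (fun m _ => zero_le_one)
      (fun m _ => by linarith [gam_pos (one_lt_qq m) (a m) s])
    simpa using h
  have hEE : (1 + δ) * E < ε / 3 := by nlinarith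
  have h3 := abs_sub_le (ν i0 * numAut R (Mod i0)) (∏ m : MaximalSpectrum R,
      ∑ i ∈ Finset.range (s + 1), (-1) ^ i * gam (qq m) (a m) i) L
  have h4 : |ν i0 * numAut R (Mod i0) - L| < ε := by linarith
  have h5 : ν i0 - muCL R ι Mod i0 = (ν i0 * numAut R (Mod i0) - L) / numAut R (Mod i0) := by
    rw [hmu, sub_div, mul_div_cancel_right₀ _ (by linarith)]
  rw [h5, abs_div, abs_of_pos (show (0 : ℝ) < numAut R (Mod i0) by linarith)]
  exact (div_le_self (abs_nonneg _) hAut1).trans_lt h4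

lemma all_modules (hreg : ∀ c : ℕ, c ≠ 0 → ∀ x : R, (c : R) * x = 0 → x = 0)
    (ι : Type) (Mod : ι → ModuleCat.{0} R) (hfin : ∀ i, Finite (Mod i))
    (hcomplete : ∀ (M : Type) [AddCommGroup M] [Module R M],
      Finite M → ∃ i, Nonempty (M ≃ₗ[R] Mod i))
    (hirr : ∀ i j, Nonempty ((Mod i : Type) ≃ₗ[R] Mod j) → i = j)
    (Sf : ℕ → Finset ι) (hSf : ∀ c j, j ∈ Sf c ↔ Nat.card (Mod j) = c)
    (S : Finset ι) (ε : ℝ) (hε : 0 < ε) :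
    ∃ δ : ℝ, 0 < δ ∧ ∃ S' : Finset ι, ∀ ν : ι → ℝ, (∀ i, 0 ≤ ν i) →
        (∀ i' ∈ S', ∃ t : ℝ,
          HasSum (fun i => ν i * (numSurj R (Mod i) (Mod i') : ℝ)) t ∧
          1 - δ ≤ t ∧ t ≤ 1 + δ) → ∀ i ∈ S, |ν i - muCL R ι Mod i| < ε := by
  classical
  induction S using Finset.induction_on with
  | empty => exact ⟨1, one_pos, ∅, fun ν _ _ i hi => by simp at hi⟩
  | insert i0 S _ ih =>
    obtain ⟨δ₁, h₁, S₁, H₁⟩ := ih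
    obtain ⟨δ₂, h₂, S₂, H₂⟩ := per_module hreg ι Mod hfin hcomplete hirr Sf hSf i0 ε hε
    refine ⟨min δ₁ δ₂, lt_min h₁ h₂, S₁ ∪ S₂, fun ν hν hm i hi => ?_⟩
    have l1 := min_le_left δ₁ δ₂
    have l2 := min_le_right δ₁ δ₂
    rcases Finset.mem_insert.1 hi with rfl | hi
    · refine H₂ ν hν fun i' hi' => ?_
      obtain ⟨t, ht, h1, h2⟩ := hm i' (Finset.mem_union_right _ hi')
      exact ⟨t, ht, by linarith, by linarith⟩
    · refine H₁ ν hν (fun i' hi' => ?_) i hi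
      obtain ⟨t, ht, h1, h2⟩ := hm i' (Finset.mem_union_left _ hi')
      exact ⟨t, ht, by linarith, by linarith⟩

end main
end FE

open Filter
set_option linter.style.haveILetI false
set_option linter.unusedSectionVars false
namespace FE

section concrete

lemma finite_of_smul_zero {Z N : Type} [CommRing Z] [AddCommGroup N] [Module Z N]
    [Module.Finite Z N] (c : Z) [Finite (Z ⧸ Ideal.span {c})] (h : ∀ x : N, c • x = 0) :
    Finite N := by
  obtain ⟨n, f, hf⟩ := Module.Finite.exists_fin' Z N
  refine Finite.of_surjective (fun v : Fin n → Z ⧸ Ideal.span {c} =>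
    f (fun j => (v j).out)) fun x => ?_
  obtain ⟨w, rfl⟩ := hf x
  refine ⟨fun j => Ideal.Quotient.mk _ (w j), ?_⟩
  have h1 : ∀ j, ∃ u : Z, (Ideal.Quotient.mk (Ideal.span {c}) (w j)).out - w j = c * u := by
    intro j
    have : (Ideal.Quotient.mk (Ideal.span {c}) (w j)).out - w j ∈ Ideal.span {c} := by
      rw [← Ideal.Quotient.eq]
      exact Quotient.out_eq _
    obtain ⟨u, hu⟩ := Ideal.mem_span_singleton'.1 this
    exact ⟨u, by rw [← hu, mul_comm]⟩
  choose u hu using h1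
  rw [← sub_eq_zero, ← map_sub]
  have : ((fun j => (Ideal.Quotient.mk (Ideal.span {c}) (w j)).out) - w) = c • u := by
    ext j
    exact hu j
  rw [this, map_smul, h]

lemma padic_quot_finite (ℓ : ℕ) [Fact ℓ.Prime] (c : ℕ) (hc : c ≠ 0) :
    Finite (ℤ_[ℓ] ⧸ Ideal.span {(c : ℤ_[ℓ])}) := by
  have hc' : (c : ℤ_[ℓ]) ≠ 0 := by exact_mod_cast hc
  have hle : RingHom.ker (PadicInt.toZModPow (p := ℓ) (c : ℤ_[ℓ]).valuation) ≤
      Ideal.span {(c : ℤ_[ℓ])} := by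
    rw [PadicInt.ker_toZModPow, Ideal.span_singleton_le_span_singleton]
    have := PadicInt.unitCoeff_spec hc'
    refine ⟨((PadicInt.unitCoeff hc')⁻¹ : ℤ_[ℓ]ˣ), ?_⟩
    generalize PadicInt.unitCoeff hc' = u at this
    generalize (c : ℤ_[ℓ]).valuation = k at this
    rw [this, mul_comm, ← mul_assoc, Units.inv_mul, one_mul]
  have : NeZero (ℓ ^ (c : ℤ_[ℓ]).valuation) := ⟨pow_ne_zero _ (Fact.out : ℓ.Prime).ne_zero⟩
  have : Finite (ℤ_[ℓ] ⧸ RingHom.ker (PadicInt.toZModPow (p := ℓ) (c : ℤ_[ℓ]).valuation)) :=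
    Finite.of_injective _ (RingHom.kerLift_injective (PadicInt.toZModPow (p := ℓ) (c : ℤ_[ℓ]).valuation))
  exact Finite.of_surjective _ (Ideal.Quotient.factor_surjective hle)

lemma finite_card_eq {R : Type} [CommRing R]
    (hq : ∀ c : ℕ, c ≠ 0 → Finite (R ⧸ Ideal.span {(c : R)}))
    (ι : Type) (Mod : ι → ModuleCat.{0} R) (hfin : ∀ i, Finite (Mod i))
    (hirr : ∀ i j, Nonempty ((Mod i : Type) ≃ₗ[R] Mod j) → i = j) (c : ℕ) :
    {i | Nat.card (Mod i) = c}.Finite := by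
  rcases eq_or_ne c 0 with rfl | hc
  · convert Set.finite_empty
    ext i
    have := hfin i
    simp only [Set.mem_ofPred_eq, Set.mem_empty_iff_false, iff_false]
    exact Nat.card_pos.ne'
  have := hq c hc
  have hg : ∀ i : {i | Nat.card (Mod i) = c},
      ∃ g : (Fin c → R ⧸ Ideal.span {(c : R)}) →ₗ[R] Mod i.1, Function.Surjective g := by
    rintro ⟨i, hi⟩
    have := hfin i
    let e : Fin c ≃ Mod i := (Finite.equivFinOfCardEq hi).symm
    let g : (Fin c → R) →ₗ[R] Mod i := Fintype.linearCombination R e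
    have hgs : Function.Surjective g := fun x => ⟨Pi.single (e.symm x) 1, by
      simp [g, Fintype.linearCombination_apply_single]⟩
    let p : (Fin c → R) →ₗ[R] (Fin c → R ⧸ Ideal.span {(c : R)}) :=
      LinearMap.pi fun j => (Submodule.mkQ (Ideal.span {(c : R)})) ∘ₗ LinearMap.proj j
    have hp : Function.Surjective p := by
      intro v
      choose w hw using fun j => Submodule.mkQ_surjective (Ideal.span {(c : R)}) (v j)
      exact ⟨w, funext hw⟩
    obtain ⟨g', hg'⟩ := factor p hp g (by
      intro w hw
      have h1 : ∀ j, ∃ u : R, c * u = w j := by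
        intro j
        have h2 : Submodule.mkQ (Ideal.span {(c : R)}) (w j) = 0 := congrFun hw j
        rw [Submodule.mkQ_apply, Submodule.Quotient.mk_eq_zero] at h2
        obtain ⟨u, hu⟩ := Ideal.mem_span_singleton'.1 h2
        exact ⟨u, by rw [← hu, mul_comm]⟩
      choose u hu using h1
      have h3 : w = (c : R) • u := by
        ext j
        exact (hu j).symm
      rw [LinearMap.mem_ker, h3, map_smul, Nat.cast_smul_eq_nsmul]
      have h4 : Nat.card (Mod i) • g u = 0 := card_nsmul_eq_zero'
      have hi' : Nat.card (Mod i) = c := hi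
      rwa [hi'] at h4)
    exact ⟨g', fun x => by
      obtain ⟨w, rfl⟩ := hgs x
      exact ⟨p w, hg' w⟩⟩
  choose g hgs using hg
  rw [← Set.finite_coe_iff]
  refine Finite.of_injective (fun i => LinearMap.ker (g i)) fun i j hij => ?_
  apply Subtype.ext
  apply hirr
  exact ⟨(((g i).quotKerEquivOfSurjective (hgs i)).symm.trans
    (Submodule.quotEquivOfEq _ _ hij)).trans ((g j).quotKerEquivOfSurjective (hgs j))⟩

lemma main_alg (ℓ : ℕ) [Fact ℓ.Prime] (R : Type) [CommRing R] [Algebra ℤ_[ℓ] R]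
    [Module.Free ℤ_[ℓ] R] [Module.Finite ℤ_[ℓ] R] (ι : Type) (Mod : ι → ModuleCat.{0} R)
    (hfin : ∀ i, Finite (Mod i))
    (hcomplete : ∀ (M : Type) [AddCommGroup M] [Module R M],
      Finite M → ∃ i, Nonempty (M ≃ₗ[R] Mod i))
    (hirr : ∀ i j, Nonempty ((Mod i : Type) ≃ₗ[R] Mod j) → i = j)
    (S : Finset ι) (ε : ℝ) (hε : 0 < ε) :
    ∃ δ : ℝ, 0 < δ ∧ ∃ S' : Finset ι, ∀ ν : ι → ℝ, (∀ i, 0 ≤ ν i) →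
        (∀ i' ∈ S', ∃ t : ℝ,
          HasSum (fun i => ν i * (numSurj R (Mod i) (Mod i') : ℝ)) t ∧
          1 - δ ≤ t ∧ t ≤ 1 + δ) → ∀ i ∈ S, |ν i - muCL R ι Mod i| < ε := by
  have hNoeth : IsNoetherianRing R := IsNoetherianRing.of_finite ℤ_[ℓ] R
  have hq : ∀ c : ℕ, c ≠ 0 → Finite (R ⧸ Ideal.span {(c : R)}) := by
    intro c hc
    have := padic_quot_finite ℓ c hc
    refine finite_of_smul_zero (Z := ℤ_[ℓ]) (c : ℤ_[ℓ]) fun x => ?_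
    obtain ⟨y, rfl⟩ := Ideal.Quotient.mk_surjective x
    rw [Nat.cast_smul_eq_nsmul, ← map_nsmul, Ideal.Quotient.eq_zero_iff_mem, nsmul_eq_mul]
    exact Ideal.mul_mem_right _ _ (Ideal.mem_span_singleton_self _)
  have hreg : ∀ c : ℕ, c ≠ 0 → ∀ x : R, (c : R) * x = 0 → x = 0 := by
    intro c hc x hx
    have h1 : (c : ℤ_[ℓ]) • x = 0 := by
      rw [Nat.cast_smul_eq_nsmul, nsmul_eq_mul, hx]
    exact (smul_eq_zero.1 h1).resolve_left (by exact_mod_cast hc)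
  have hmem : ∀ m : MaximalSpectrum R, Ideal.span {((ℓ : ℕ) : R)} ≤ m.asIdeal := by
    intro m
    have hm := m.isMaximal
    have hI : (algebraMap ℤ_[ℓ] R).IsIntegral := fun x => IsIntegral.of_finite ℤ_[ℓ] x
    have h1 : (m.asIdeal.comap (algebraMap ℤ_[ℓ] R)).IsMaximal :=
      Ideal.isMaximal_comap_of_isIntegral_of_isMaximal' (algebraMap ℤ_[ℓ] R) hI m.asIdeal
    have h2 := IsLocalRing.eq_maximalIdeal h1
    rw [Ideal.span_singleton_le_iff_mem, ← map_natCast (algebraMap ℤ_[ℓ] R), ← Ideal.mem_comap, h2,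
      PadicInt.maximalIdeal_eq_span_p]
    exact Ideal.mem_span_singleton_self _
  have hℓ := hq ℓ (Fact.out : ℓ.Prime).ne_zero
  have hfq : ∀ m : MaximalSpectrum R, Finite (R ⧸ m.asIdeal) := fun m =>
    Finite.of_surjective _ (Ideal.Quotient.factor_surjective (hmem m))
  have hfI : Finite (Ideal (R ⧸ Ideal.span {((ℓ : ℕ) : R)})) :=
    Finite.of_injective (fun I : Ideal (R ⧸ Ideal.span {((ℓ : ℕ) : R)}) =>
      (I : Set (R ⧸ Ideal.span {((ℓ : ℕ) : R)}))) SetLike.coe_injective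
  have : Finite (MaximalSpectrum R) := by
    refine Finite.of_injective (fun m : MaximalSpectrum R =>
      m.asIdeal.map (Ideal.Quotient.mk (Ideal.span {((ℓ : ℕ) : R)}))) fun m m' h => ?_
    apply MaximalSpectrum.ext
    rw [← Ideal.comap_map_mk (hmem m), ← Ideal.comap_map_mk (hmem m')]
    exact congrArg _ h
  have := Fintype.ofFinite (MaximalSpectrum R)
  have hfc := finite_card_eq hq ι Mod hfin hirr
  exact all_modules hreg ι Mod hfin hcomplete hirr (fun c => (hfc c).toFinset)
    (fun c j => by simp) S ε hε

end concrete
end FE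

theorem statement19 (ℓ : ℕ) [Fact ℓ.Prime] (hodd : ℓ ≠ 2)
    (q : ℕ) (hq : ∃ r k : ℕ, r.Prime ∧ 0 < k ∧ q = r ^ k)
    (P : Polynomial ℤ_[ℓ]) (hP : P.Monic)
    (hPq : ¬ ((ℓ : ℤ_[ℓ]) ∣ Polynomial.eval (q : ℤ_[ℓ]) P))
    (hfew : HasFewEnlargements (Polynomial ℤ_[ℓ] ⧸ Ideal.span {P}))
    -- `Mod : ι → ModuleCat R` is a complete irredundant family of representatives of the
    -- isomorphism classes of all finite modules over `R = ℤ_ℓ[x]/(P)`: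
    (ι : Type) (Mod : ι → ModuleCat.{0} (Polynomial ℤ_[ℓ] ⧸ Ideal.span {P}))
    (hfin : ∀ i, Finite (Mod i))
    (hcomplete : ∀ (M : Type) [AddCommGroup M] [Module (Polynomial ℤ_[ℓ] ⧸ Ideal.span {P}) M],
      Finite M → ∃ i, Nonempty (M ≃ₗ[Polynomial ℤ_[ℓ] ⧸ Ideal.span {P}] Mod i))
    (hirr : ∀ i j, Nonempty ((Mod i : Type) ≃ₗ[Polynomial ℤ_[ℓ] ⧸ Ideal.span {P}] Mod j) →
      i = j)
    (S : Finset ι) (ε : ℝ) (hε : 0 < ε) :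
    ∃ δ : ℝ, 0 < δ ∧ ∃ S' : Finset ι,
      ∀ ν : ι → ℝ, (∀ i, 0 ≤ ν i) → HasSum ν 1 →
        (∀ i' ∈ S', ∃ t : ℝ,
          HasSum (fun i => ν i *
            (numSurj (Polynomial ℤ_[ℓ] ⧸ Ideal.span {P}) (Mod i) (Mod i') : ℝ)) t ∧
          1 - δ ≤ t ∧ t ≤ 1 + δ) →
        ∀ i ∈ S,
          |ν i - muCL (Polynomial ℤ_[ℓ] ⧸ Ideal.span {P}) ι Mod i| < ε := by
  have h1 := hP.free_quotient
  have h2 := hP.finite_quotient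
  obtain ⟨δ, hδ, S', H⟩ := FE.main_alg ℓ (Polynomial ℤ_[ℓ] ⧸ Ideal.span {P}) ι Mod hfin hcomplete
    hirr S ε hε
  exact ⟨δ, hδ, S', fun ν hν _ hm => H ν hν hm⟩
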